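/- arXiv:2509.24747 — 3 statements merged into one kernel-verified Lean document; each statement's English description precedes it below -/
import Mathlib

section
/- Let v ∈ {𝔭₀, ℓ}, where 𝔭₀ = log on (0,∞) and ℓ(x) = −log(−x) on (−∞,0). Then there exist random variables X, X₁, X₂ ∈ 𝓛¹_v such that: (a) X = X₁ + X₂ ℙ-a.s.; (b) the allocation (X₁, X₂) of X is not comonotone; and (c) no comonotone allocation (Y₁, Y₂) of X with Y₁, Y₂ ∈ 𝓛¹_v satisfies both X₁ ≤_{v-SD} Y₁ and X₂ ≤_{v-SD} Y₂. -/
open MeasureTheory Filter Set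

noncomputable section

namespace Paper

variable {Ω : Type*} [MeasurableSpace Ω]

/-- The probability measure `P` is atomless. -/
def Atomless (P : Measure Ω) : Prop :=
  ∀ s : Set Ω, MeasurableSet s → 0 < P s →
    ∃ t : Set Ω, MeasurableSet t ∧ t ⊆ s ∧ 0 < P t ∧ P t < P s

/-- `𝒳`: the essentially bounded random variables. -/
def MemX (P : Measure Ω) (X : Ω → ℝ) : Prop :=
  Measurable X ∧ ∃ C : ℝ, ∀ᵐ ω ∂P, |X ω| ≤ C

/-- `𝒰(I)`: twice differentiable functions with everywhere positive first
derivative on `I`. -/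
def IsUtility (I : Set ℝ) (u : ℝ → ℝ) : Prop :=
  (∀ x ∈ I, DifferentiableAt ℝ u x) ∧
  (∀ x ∈ I, DifferentiableAt ℝ (deriv u) x) ∧
  (∀ x ∈ I, 0 < deriv u x)

/-- Arrow–Pratt coefficient of absolute risk aversion. -/
def RA (u : ℝ → ℝ) (x : ℝ) : ℝ := -deriv (deriv u) x / deriv u x

/-- `𝓛¹_v`: `I`-valued random variables `X` with `v(X)` integrable. -/
def MemL1 (P : Measure Ω) (I : Set ℝ) (v : ℝ → ℝ) (X : Ω → ℝ) : Prop :=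
  Measurable X ∧ (∀ᵐ ω ∂P, X ω ∈ I) ∧ Integrable (fun ω => v (X ω)) P

/-- The `v`-SD order: `X ≤_{v-SD} Y`. -/
def vSD (P : Measure Ω) (I : Set ℝ) (v : ℝ → ℝ) (X Y : Ω → ℝ) : Prop :=
  ∀ u : ℝ → ℝ, IsUtility I u → (∀ x ∈ I, RA v x ≤ RA u x) →
    Integrable (fun ω => u (X ω)) P → Integrable (fun ω => u (Y ω)) P →
    ∫ ω, u (X ω) ∂P ≤ ∫ ω, u (Y ω) ∂P

/-- Second-order stochastic dominance. -/
def SSD (P : Measure Ω) (X Y : Ω → ℝ) : Prop :=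
  ∀ u : ℝ → ℝ, IsUtility Set.univ u → ConcaveOn ℝ Set.univ u →
    Integrable (fun ω => u (X ω)) P → Integrable (fun ω => u (Y ω)) P →
    ∫ ω, u (X ω) ∂P ≤ ∫ ω, u (Y ω) ∂P

/-- Monetary risk measure: antitone and cash-additive on `𝒳`. -/
def IsRiskMeasure (P : Measure Ω) (ρ : (Ω → ℝ) → ℝ) : Prop :=
  (∀ X Y : Ω → ℝ, MemX P X → MemX P Y → (∀ᵐ ω ∂P, X ω ≤ Y ω) → ρ Y ≤ ρ X) ∧
  (∀ X : Ω → ℝ, MemX P X → ∀ c : ℝ, ρ (fun ω => X ω + c) = ρ X - c)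

/-- Worst-case risk measure `ρ^w(X) = ess sup (-X)`. -/
def rhoW (P : Measure Ω) (X : Ω → ℝ) : ℝ :=
  sInf {m : ℝ | ∀ᵐ ω ∂P, -X ω ≤ m}

/-- `v`-SD-consistency of `φ` on the domain `D`. -/
def VSDConsistent (P : Measure Ω) (I : Set ℝ) (v : ℝ → ℝ)
    (D : Set (Ω → ℝ)) (φ : (Ω → ℝ) → ℝ) : Prop :=
  ∀ X Y : Ω → ℝ, X ∈ D → Y ∈ D → MemL1 P I v X → MemL1 P I v Y →
    vSD P I v X Y → φ Y ≤ φ X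

/-- `𝒞`: the a.s. strictly positive bounded random variables. -/
def MemC (P : Measure Ω) (X : Ω → ℝ) : Prop :=
  MemX P X ∧ ∀ᵐ ω ∂P, 0 < X ω

/-- `𝓔 = {e^Y : Y ∈ 𝒳}` (up to a.s. equality). -/
def MemE (P : Measure Ω) (X : Ω → ℝ) : Prop :=
  ∃ Y : Ω → ℝ, MemX P Y ∧ ∀ᵐ ω ∂P, X ω = Real.exp (Y ω)

/-- Return risk measure. -/
def IsRRM (P : Measure Ω) (η : (Ω → ℝ) → ℝ) : Prop :=
  (∀ X : Ω → ℝ, MemC P X → 0 < η X) ∧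
  (∀ X Y : Ω → ℝ, MemC P X → MemC P Y → (∀ᵐ ω ∂P, X ω ≤ Y ω) → η Y ≤ η X) ∧
  (∀ X : Ω → ℝ, MemC P X → ∀ t : ℝ, 0 < t → η (fun ω => t * X ω) = t⁻¹ * η X)

/-- Loss-based return risk measure. -/
def IsLossRRM (P : Measure Ω) (κ : (Ω → ℝ) → ℝ) : Prop :=
  (∀ L : Ω → ℝ, MemC P L → 0 < κ L) ∧
  (∀ L L' : Ω → ℝ, MemC P L → MemC P L' → (∀ᵐ ω ∂P, L' ω ≤ L ω) → κ L' ≤ κ L) ∧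
  (∀ L : Ω → ℝ, MemC P L → ∀ t : ℝ, 0 < t → κ (fun ω => t * L ω) = t * κ L)

/-- Base risk measure `ρ_{Z,v}`. -/
def baseRM (P : Measure Ω) (v : ℝ → ℝ) (Z X : Ω → ℝ) : ℝ :=
  sInf {m : ℝ | vSD P Set.univ v Z (fun ω => X ω + m)}

/-- Lower quantile function. -/
def qf (P : Measure Ω) (X : Ω → ℝ) (r : ℝ) : ℝ :=
  sInf {x : ℝ | r ≤ (P {ω | X ω ≤ x}).toReal}

/-- Expected Shortfall at level `p`. -/
def ES (P : Measure Ω) (p : ℝ) (X : Ω → ℝ) : ℝ :=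
  if p < 1 then -(1 / (1 - p)) * ∫ r in (0:ℝ)..(1 - p), qf P X r
  else rhoW P X

/-- Comonotone allocation `(Y₁, Y₂)` of `X` over the interval `I`. -/
def IsComonotoneAlloc (P : Measure Ω) (I : Set ℝ) (X Y₁ Y₂ : Ω → ℝ) : Prop :=
  ∃ f₁ f₂ : ℝ → ℝ, MonotoneOn f₁ I ∧ MonotoneOn f₂ I ∧
    (∀ x ∈ I, f₁ x ∈ I) ∧ (∀ x ∈ I, f₂ x ∈ I) ∧
    (∀ x ∈ I, f₁ x + f₂ x = x) ∧
    (∀ᵐ ω ∂P, Y₁ ω = f₁ (X ω)) ∧ (∀ᵐ ω ∂P, Y₂ ω = f₂ (X ω))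

theorem vSD_self (P : Measure Ω) (I : Set ℝ) (v : ℝ → ℝ) (X : Ω → ℝ) : vSD P I v X X :=
  fun _ _ _ _ _ => le_rfl

theorem atomless_half (P : Measure Ω) [IsProbabilityMeasure P] (hP : Atomless P)
    (s : Set Ω) (hs : MeasurableSet s) (h0 : 0 < P s) :
    ∃ t, MeasurableSet t ∧ t ⊆ s ∧ 0 < P t ∧ P t ≤ P s / 2 := by
  obtain ⟨t, ht, hts, ht0, htl⟩ := hP s hs h0
  have hadd : P t + P (s \ t) = P s := by
    rw [measure_sdiff hts ht.nullMeasurableSet (measure_ne_top _ _)]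
    exact add_tsub_cancel_of_le htl.le
  by_cases hc : P t ≤ P s / 2
  · exact ⟨t, ht, hts, ht0, hc⟩
  · refine ⟨s \ t, hs.diff ht, sdiff_subset, ?_, ?_⟩
    · rw [measure_sdiff hts ht.nullMeasurableSet (measure_ne_top _ _)]
      exact tsub_pos_of_lt htl
    · push Not at hc
      by_contra hcc
      push Not at hcc
      have := ENNReal.add_lt_add hc hcc
      rw [ENNReal.add_halves, hadd] at this
      exact lt_irrefl _ this

theorem exists_seq (P : Measure Ω) [IsProbabilityMeasure P] (hP : Atomless P) :
    ∃ A : ℕ → Set Ω, (∀ n, MeasurableSet (A n)) ∧ Antitone A ∧ (∀ n, 0 < P (A n)) ∧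
      ∀ n, P (A n) ≤ (2⁻¹ : ENNReal) ^ n := by
  choose! T hT using fun (s : Set Ω) (h : MeasurableSet s ∧ 0 < P s) =>
    atomless_half P hP s h.1 h.2
  let A : ℕ → Set Ω := fun n => T^[n] univ
  have hS : ∀ n, A (n+1) = T (A n) := fun n => Function.iterate_succ_apply' T n univ
  have hA : ∀ n, MeasurableSet (A n) ∧ 0 < P (A n) := by
    intro n
    induction n with
    | zero => simp [A]
    | succ n ih => rw [hS]; exact ⟨(hT _ ih).1, (hT _ ih).2.2.1⟩
  refine ⟨A, fun n => (hA n).1, antitone_nat_of_succ_le fun n => ?_, fun n => (hA n).2, ?_⟩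
  · rw [hS]; exact (hT _ (hA n)).2.1
  · intro n
    induction n with
    | zero => simp [A]
    | succ n ih =>
      rw [hS, pow_succ]
      refine (hT _ (hA n)).2.2.2.trans ?_
      rw [ENNReal.div_eq_inv_mul, mul_comm]
      gcongr

/-- An integrable nonnegative, essentially unbounded random variable. -/
theorem exists_unbounded (P : Measure Ω) [IsProbabilityMeasure P] (hP : Atomless P) :
    ∃ g : Ω → ℝ, Measurable g ∧ (∀ ω, 0 ≤ g ω) ∧ Integrable g P ∧
      ∀ n : ℕ, ∃ B, MeasurableSet B ∧ 0 < P B ∧ ∀ᵐ ω ∂P, ω ∈ B → (n : ℝ) ≤ g ω := by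
  obtain ⟨A, hA, hanti, hpos, hle⟩ := exists_seq P hP
  let G : Ω → ENNReal := fun ω => ∑' n, (A n).indicator 1 ω
  have hG : Measurable G := Measurable.ennreal_tsum fun n => measurable_one.indicator (hA n)
  have hint : ∫⁻ ω, G ω ∂P ≠ ⊤ := by
    rw [lintegral_tsum fun n => (measurable_one.indicator (hA n)).aemeasurable]
    simp_rw [lintegral_indicator_one (hA _)]
    refine ne_top_of_le_ne_top ?_ (ENNReal.tsum_le_tsum hle)
    rw [ENNReal.tsum_geometric]
    simp
  refine ⟨fun ω => (G ω).toReal, hG.ennreal_toReal, fun _ => ENNReal.toReal_nonneg,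
    integrable_toReal_of_lintegral_ne_top hG.aemeasurable hint, fun n => ⟨A n, hA n, hpos n, ?_⟩⟩
  filter_upwards [ae_lt_top hG hint] with ω hω hmem
  have h1 : (n : ENNReal) ≤ G ω := by
    calc (n : ENNReal) = ∑ i ∈ Finset.range n, (A i).indicator (1 : Ω → ENNReal) ω := by
          rw [Finset.sum_congr rfl (g := fun _ => (1 : ENNReal))]
          · simp
          · intro i hi
            have : ω ∈ A i := hanti (Finset.mem_range.1 hi).le hmem
            simp [this]
      _ ≤ G ω := ENNReal.sum_le_tsum _
  have := ENNReal.toReal_mono hω.ne h1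
  simpa using this

theorem util_deriv (k : ℕ) : deriv (fun x : ℝ => -(x ^ (-(k:ℤ)))) =
    fun x => (k:ℝ) * x ^ (-(k:ℤ) - 1) := by
  funext x
  rw [deriv.fun_neg, deriv_zpow]
  push_cast
  ring

theorem util_deriv2 (k : ℕ) (x : ℝ) : deriv (deriv (fun x : ℝ => -(x ^ (-(k:ℤ))))) x =
    (k:ℝ) * ((-(k:ℝ) - 1) * x ^ (-(k:ℤ) - 1 - 1)) := by
  rw [util_deriv, deriv_const_mul_field, deriv_zpow]
  push_cast
  ring

theorem util_isUtility (k : ℕ) (hk : 0 < k) :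
    IsUtility (Ioi 0) (fun x : ℝ => -(x ^ (-(k:ℤ)))) := by
  refine ⟨fun x hx => ?_, fun x hx => ?_, fun x hx => ?_⟩
  · exact (differentiableAt_zpow.2 (Or.inl (ne_of_gt hx))).neg
  · rw [util_deriv]
    exact (differentiableAt_zpow.2 (Or.inl (ne_of_gt hx))).const_mul _
  · rw [util_deriv]
    have hx' : (0:ℝ) < x := hx
    positivity

theorem util_RA (k : ℕ) (hk : 0 < k) (x : ℝ) (hx : x ∈ Ioi (0:ℝ)) :
    RA Real.log x ≤ RA (fun x : ℝ => -(x ^ (-(k:ℤ)))) x := by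
  have hx' : (0:ℝ) < x := hx
  have hk' : (0:ℝ) < k := by exact_mod_cast hk
  have h1 : RA Real.log x = 1 / x := by
    unfold RA
    rw [Real.deriv_log', deriv_inv]
    field_simp
  have h2 : RA (fun x : ℝ => -(x ^ (-(k:ℤ)))) x = ((k:ℝ) + 1) / x := by
    unfold RA
    rw [util_deriv2, util_deriv, zpow_sub_one₀ hx'.ne' (-(k:ℤ) - 1)]
    have : x ^ (-(k:ℤ) - 1) ≠ 0 := (zpow_pos hx' _).ne'
    field_simp
    ring
  rw [h1, h2]
  gcongr
  linarith

theorem log_case (P : Measure Ω) [IsProbabilityMeasure P] (hP : Atomless P) :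
    ∃ X X₁ X₂ : Ω → ℝ, MemL1 P (Ioi 0) Real.log X ∧ MemL1 P (Ioi 0) Real.log X₁ ∧
      MemL1 P (Ioi 0) Real.log X₂ ∧
      (∀ᵐ ω ∂P, X ω = X₁ ω + X₂ ω) ∧
      ∀ Y₁ Y₂ : Ω → ℝ, Measurable Y₂ →
        IsComonotoneAlloc P (Ioi 0) X Y₁ Y₂ →
        ¬ (vSD P (Ioi 0) Real.log X₁ Y₁ ∧ vSD P (Ioi 0) Real.log X₂ Y₂) := by
  obtain ⟨g, hg, hg0, hgi, hgB⟩ := exists_unbounded P hP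
  have hm1 : Measurable fun ω => Real.exp (-g ω) := Real.measurable_exp.comp hg.neg
  have hle1 : ∀ ω, Real.exp (-g ω) ≤ 1 := fun ω => Real.exp_le_one_iff.2 (by linarith [hg0 ω])
  refine ⟨fun ω => Real.exp (-g ω) + 1, fun ω => Real.exp (-g ω), fun _ => 1,
    ⟨hm1.add_const 1, ae_of_all _ fun ω => ?_, ?_⟩, ⟨hm1, ae_of_all _ fun ω => ?_, ?_⟩,
    ⟨measurable_const, ae_of_all _ fun ω => ?_, ?_⟩, ae_of_all _ fun ω => rfl, ?_⟩
  · simp only [mem_Ioi]; positivity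
  · refine Integrable.of_bound (Real.measurable_log.comp (hm1.add_const 1)).aestronglyMeasurable
      (Real.log 2) (ae_of_all _ fun ω => ?_)
    have h0 := Real.exp_pos (-g ω)
    rw [Real.norm_of_nonneg (Real.log_nonneg (by linarith))]
    exact Real.log_le_log (by linarith) (by linarith [hle1 ω])
  · exact Real.exp_pos _
  · simp only [Real.log_exp]
    exact hgi.neg
  · simp
  · simp
  rintro Y₁ Y₂ hY₂ ⟨f₁, f₂, hf₁, hf₂, hf₁I, hf₂I, hsum, -, hY⟩ ⟨-, hsd⟩
  have one : (1:ℝ) ∈ Ioi (0:ℝ) := by simp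
  have hc0 : 0 < f₂ 1 := hf₂I 1 one
  have hc1 : f₂ 1 < 1 := by
    have h1 : 0 < f₁ 1 := hf₁I 1 one
    have := hsum 1 one
    linarith
  have hXm : ∀ ω, Real.exp (-g ω) + 1 ∈ Ioi (0:ℝ) := fun ω => by
    simp only [mem_Ioi]; positivity
  have hlow : ∀ᵐ ω ∂P, f₂ 1 ≤ Y₂ ω := by
    filter_upwards [hY] with ω hω
    rw [hω]
    exact hf₂ one (hXm ω) (by linarith [Real.exp_pos (-g ω)])
  have hup : ∀ᵐ ω ∂P, Y₂ ω ≤ f₂ 1 + Real.exp (-g ω) := by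
    filter_upwards [hY] with ω hω
    rw [hω]
    have h1 := hf₁ one (hXm ω) (by linarith [Real.exp_pos (-g ω)])
    have h2 := hsum _ (hXm ω)
    have h3 := hsum 1 one
    linarith
  -- choose a set of positive measure where `Y₂ ≤ d < 1`
  set d : ℝ := (1 + f₂ 1) / 2 with hd
  have hd1 : d < 1 := by rw [hd]; linarith
  have hd0 : 0 < d := by rw [hd]; linarith
  obtain ⟨n, hn⟩ := exists_nat_ge (-Real.log ((1 - f₂ 1) / 2))
  obtain ⟨B, hB, hB0, hBn⟩ := hgB n
  have hBd : ∀ᵐ ω ∂P, ω ∈ B → Y₂ ω ≤ d := by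
    filter_upwards [hup, hBn] with ω h1 h2 hω
    have h3 : Real.exp (-g ω) ≤ (1 - f₂ 1) / 2 := by
      rw [← Real.le_log_iff_exp_le (by linarith)]
      linarith [h2 hω]
    rw [hd]; linarith
  have hq0 : 0 < P.real B := ENNReal.toReal_pos hB0.ne' (measure_ne_top _ _)
  obtain ⟨k, hk⟩ := exists_pow_lt_of_lt_one hq0 hd1
  have hkk : ∃ k : ℕ, 0 < k ∧ d ^ k < P.real B := by
    refine ⟨k + 1, Nat.succ_pos _, lt_of_le_of_lt ?_ hk⟩
    exact pow_le_pow_of_le_one hd0.le hd1.le (Nat.le_succ k)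
  clear hk k
  obtain ⟨k, hk0, hk⟩ := hkk
  have hYint : Integrable (fun ω => (Y₂ ω) ^ (-(k:ℤ))) P := by
    refine Integrable.of_bound (C := (f₂ 1) ^ (-(k:ℤ))) ?_ ?_
    · simp only [zpow_neg, zpow_natCast]
      exact (hY₂.pow_const k).inv.aestronglyMeasurable
    filter_upwards [hlow] with ω hω
    have : 0 < Y₂ ω := lt_of_lt_of_le hc0 hω
    rw [Real.norm_of_nonneg (by positivity)]
    simp only [zpow_neg, zpow_natCast]
    gcongr
  have key := hsd (fun x : ℝ => -(x ^ (-(k:ℤ)))) (util_isUtility k hk0) (util_RA k hk0)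
    (integrable_const _) hYint.neg
  simp only [one_zpow, integral_neg, integral_const, probReal_univ, smul_eq_mul] at key
  have hlb : P.real B * (d ^ k)⁻¹ ≤ ∫ ω, (Y₂ ω) ^ (-(k:ℤ)) ∂P := by
    have : ∫ ω, B.indicator (fun _ => (d ^ k)⁻¹) ω ∂P = P.real B * (d ^ k)⁻¹ := by
      rw [integral_indicator_const _ hB, smul_eq_mul]
    rw [← this]
    refine integral_mono_ae ((integrable_const _).indicator hB) hYint ?_
    filter_upwards [hlow, hBd] with ω h1 h2
    have : 0 < Y₂ ω := lt_of_lt_of_le hc0 h1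
    by_cases hω : ω ∈ B
    · simp only [hω, indicator_of_mem, zpow_neg, zpow_natCast]
      have := h2 hω
      gcongr
    · simp only [hω, not_false_eq_true, indicator_of_notMem]
      positivity
  have : 1 < P.real B * (d ^ k)⁻¹ := by
    rw [← div_eq_mul_inv, one_lt_div (by positivity)]
    exact hk
  linarith

theorem ell_deriv : deriv (fun x : ℝ => -Real.log (-x)) = fun x => -x⁻¹ := by
  have : (fun x : ℝ => -Real.log (-x)) = fun x => -Real.log x := by
    funext x; rw [Real.log_neg_eq_log]
  rw [this]
  funext x
  rw [deriv.fun_neg, Real.deriv_log]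

theorem ell_isUtility : IsUtility (Iio 0) (fun x : ℝ => -Real.log (-x)) := by
  refine ⟨fun x hx => ?_, fun x hx => ?_, fun x hx => ?_⟩
  · have : -x ≠ 0 := neg_ne_zero.2 (ne_of_lt hx)
    exact (DifferentiableAt.log differentiableAt_id.neg this).neg
  · rw [ell_deriv]
    exact (differentiableAt_inv (ne_of_lt hx)).neg
  · rw [ell_deriv]
    have : x⁻¹ < 0 := inv_lt_zero.2 hx
    simpa using this

theorem ell_case (P : Measure Ω) [IsProbabilityMeasure P] (hP : Atomless P) :
    ∃ X X₁ X₂ : Ω → ℝ, MemL1 P (Iio 0) (fun x => -Real.log (-x)) X ∧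
      MemL1 P (Iio 0) (fun x => -Real.log (-x)) X₁ ∧
      MemL1 P (Iio 0) (fun x => -Real.log (-x)) X₂ ∧
      (∀ᵐ ω ∂P, X ω = X₁ ω + X₂ ω) ∧
      ∀ Y₁ Y₂ : Ω → ℝ, Measurable Y₂ →
        IsComonotoneAlloc P (Iio 0) X Y₁ Y₂ →
        ¬ (vSD P (Iio 0) (fun x => -Real.log (-x)) X₁ Y₁ ∧
          vSD P (Iio 0) (fun x => -Real.log (-x)) X₂ Y₂) := by
  classical
  obtain ⟨A, hA, -, hA0, hA1⟩ := hP univ MeasurableSet.univ (by simp)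
  rw [measure_univ] at hA1
  have hp0 : 0 < P.real A := ENNReal.toReal_pos hA0.ne' (measure_ne_top _ _)
  have hp1 : P.real A < 1 := by
    have := (ENNReal.toReal_lt_toReal (measure_ne_top P A) ENNReal.one_ne_top).2 hA1
    simpa [Measure.real] using this
  have e1 : (fun ω => -Real.log (-(if ω ∈ A then (-1:ℝ) else -2))) =
      Aᶜ.indicator fun _ => -Real.log 2 := by
    funext ω
    by_cases h : ω ∈ A <;> simp [h]
  have e2 : (fun ω => -Real.log (-(if ω ∈ A then (-2:ℝ) else -1))) =
      A.indicator fun _ => -Real.log 2 := by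
    funext ω
    by_cases h : ω ∈ A <;> simp [h]
  have i1 : Integrable (fun ω => -Real.log (-(if ω ∈ A then (-1:ℝ) else -2))) P := by
    rw [e1]; exact (integrable_const _).indicator hA.compl
  have i2 : Integrable (fun ω => -Real.log (-(if ω ∈ A then (-2:ℝ) else -1))) P := by
    rw [e2]; exact (integrable_const _).indicator hA
  refine ⟨fun _ => -3, fun ω => if ω ∈ A then -1 else -2, fun ω => if ω ∈ A then -2 else -1,
    ⟨measurable_const, ae_of_all _ fun ω => by simp, integrable_const _⟩,
    ⟨Measurable.ite hA measurable_const measurable_const, ae_of_all _ fun ω => ?_, i1⟩,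
    ⟨Measurable.ite hA measurable_const measurable_const, ae_of_all _ fun ω => ?_, i2⟩,
    ae_of_all _ fun ω => ?_, ?_⟩
  · by_cases h : ω ∈ A <;> simp [h]
  · by_cases h : ω ∈ A <;> simp [h]
  · by_cases h : ω ∈ A <;> simp only [h, if_true, if_false] <;> norm_num
  rintro Y₁ Y₂ - ⟨f₁, f₂, -, -, hf₁I, hf₂I, hsum, hY₁, hY₂⟩ ⟨hs1, hs2⟩
  have h3 : (-3:ℝ) ∈ Iio (0:ℝ) := by simp
  have hc : f₁ (-3) < 0 := hf₁I _ h3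
  have hd : f₂ (-3) < 0 := hf₂I _ h3
  have hcd := hsum _ h3
  have g1 : (fun ω => -Real.log (-Y₁ ω)) =ᵐ[P] fun _ => -Real.log (-f₁ (-3)) := by
    filter_upwards [hY₁] with ω h; rw [h]
  have g2 : (fun ω => -Real.log (-Y₂ ω)) =ᵐ[P] fun _ => -Real.log (-f₂ (-3)) := by
    filter_upwards [hY₂] with ω h; rw [h]
  have k1 := hs1 _ ell_isUtility (fun _ _ => le_rfl) i1 ((integrable_const _).congr g1.symm)
  have k2 := hs2 _ ell_isUtility (fun _ _ => le_rfl) i2 ((integrable_const _).congr g2.symm)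
  simp only at k1 k2
  rw [integral_congr_ae g1, e1, integral_indicator_const _ hA.compl, probReal_compl_eq_one_sub hA]
    at k1
  rw [integral_congr_ae g2, e2, integral_indicator_const _ hA] at k2
  simp only [smul_eq_mul, integral_const, probReal_univ, one_mul] at k1 k2
  set p := P.real A
  have b1 : -f₁ (-3) ≤ (2:ℝ) ^ (1 - p) := by
    rw [← Real.log_le_log_iff (by linarith) (by positivity), Real.log_rpow (by norm_num)]
    linarith
  have b2 : -f₂ (-3) ≤ (2:ℝ) ^ p := by
    rw [← Real.log_le_log_iff (by linarith) (by positivity), Real.log_rpow (by norm_num)]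
    linarith
  have c1 := rpow_one_add_lt_one_add_mul_self (s := 1) (p := 1 - p) (by norm_num)
    (by norm_num) (by linarith) (by linarith)
  have c2 := rpow_one_add_lt_one_add_mul_self (s := 1) (p := p) (by norm_num)
    (by norm_num) (by linarith) (by linarith)
  norm_num at c1 c2
  linarith

/-- For `v ∈ {𝔭₀, ℓ}` there exist `X, X₁, X₂ ∈ 𝓛¹_v` with
`X = X₁ + X₂` a.s., `(X₁, X₂)` not comonotone, and no comonotone allocation of
`X` improving `(X₁, X₂)` in the `v`-SD order. -/
theorem statement4 (P : Measure Ω) [IsProbabilityMeasure P] (hP : Atomless P)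
    (I : Set ℝ) (v : ℝ → ℝ)
    (hv : (I = Set.Ioi 0 ∧ v = Real.log) ∨
          (I = Set.Iio 0 ∧ v = fun x => -Real.log (-x))) :
    ∃ X X₁ X₂ : Ω → ℝ, MemL1 P I v X ∧ MemL1 P I v X₁ ∧ MemL1 P I v X₂ ∧
      (∀ᵐ ω ∂P, X ω = X₁ ω + X₂ ω) ∧
      ¬ IsComonotoneAlloc P I X X₁ X₂ ∧
      (∀ Y₁ Y₂ : Ω → ℝ, MemL1 P I v Y₁ → MemL1 P I v Y₂ →
        (∀ᵐ ω ∂P, Y₁ ω + Y₂ ω = X ω) → IsComonotoneAlloc P I X Y₁ Y₂ →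
        ¬ (vSD P I v X₁ Y₁ ∧ vSD P I v X₂ Y₂)) := by
  have main : ∃ X X₁ X₂ : Ω → ℝ, MemL1 P I v X ∧ MemL1 P I v X₁ ∧ MemL1 P I v X₂ ∧
      (∀ᵐ ω ∂P, X ω = X₁ ω + X₂ ω) ∧
      ∀ Y₁ Y₂ : Ω → ℝ, Measurable Y₂ → IsComonotoneAlloc P I X Y₁ Y₂ →
        ¬ (vSD P I v X₁ Y₁ ∧ vSD P I v X₂ Y₂) := by
    rcases hv with ⟨rfl, rfl⟩ | ⟨rfl, rfl⟩
    · exact log_case P hP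
    · exact ell_case P hP
  obtain ⟨X, X₁, X₂, h, h1, h2, hs, hn⟩ := main
  exact ⟨X, X₁, X₂, h, h1, h2, hs,
    fun hc => hn X₁ X₂ h2.1 hc ⟨vSD_self _ _ _ _, vSD_self _ _ _ _⟩,
    fun Y₁ Y₂ _ hY₂ _ hc => hn Y₁ Y₂ hY₂.1 hc⟩

end Paper
end
end

section
/- Let c < 0. A monetary risk measure ρ: 𝒳 → ℝ is 𝔢_c-SD-consistent if and only if there exists a family 𝒢 of nondecreasing functions g: [0,1] → (0,∞) such that for all X ∈ 𝒳, ρ(X) = inf_{g∈𝒢} sup_{p∈[0,1]} (1/|c|)·log( ES_p(−e^{cX}) / g(p) ). -/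
open MeasureTheory Filter Set

noncomputable section

namespace Paper

variable {Ω : Type*} [MeasurableSpace Ω]

lemma weight_nonneg (w D : ℝ → ℝ) (M : ℝ) (hw : Antitone w)
    (h0 : ∀ r ∈ Ioc (0:ℝ) 1, 0 ≤ w r) (hM : ∀ r ∈ Ioc (0:ℝ) 1, w r ≤ M)
    (hD : IntegrableOn D (Ioc 0 1))
    (hpos : ∀ α ∈ Icc (0:ℝ) 1, 0 ≤ ∫ r in (0:ℝ)..α, D r) :
    0 ≤ ∫ r in Ioc (0:ℝ) 1, w r * D r := by
  have e1 : ∫ r in Ioc (0:ℝ) 1, w r * D r =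
      ∫ r in Ioc (0:ℝ) 1, ∫ t in Ioc (0:ℝ) M, {p : ℝ × ℝ | p.2 < w p.1}.indicator
        (fun p => D p.1) (r, t) := by
    apply setIntegral_congr_fun measurableSet_Ioc
    intro r hr
    have : (fun t => {p : ℝ × ℝ | p.2 < w p.1}.indicator (fun p => D p.1) (r, t)) =
        (Iio (w r)).indicator (fun _ => D r) := by
      funext t
      simp [indicator]
    simp only [this]
    rw [setIntegral_indicator measurableSet_Iio]
    have hs : Ioc 0 M ∩ Iio (w r) = Ioo 0 (w r) := by
      ext t
      have := hM r hr
      simp only [mem_inter_iff, mem_Ioc, mem_Iio, mem_Ioo]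
      constructor
      · rintro ⟨⟨a, b⟩, c⟩; exact ⟨a, c⟩
      · rintro ⟨a, b⟩; exact ⟨⟨a, by linarith⟩, b⟩
    rw [hs, setIntegral_const]
    simp [measureReal_def, ENNReal.toReal_ofReal (h0 r hr)]
  have hms : MeasurableSet {p : ℝ × ℝ | p.2 < w p.1} :=
    measurableSet_lt measurable_snd (hw.measurable.comp measurable_fst)
  rw [e1, integral_integral_swap (f := fun r t => {p : ℝ × ℝ | p.2 < w p.1}.indicator
        (fun p => D p.1) (r, t))]
  · apply integral_nonneg
    intro t
    have : (fun r => {p : ℝ × ℝ | p.2 < w p.1}.indicator (fun p => D p.1) (r, t)) =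
        {r | t < w r}.indicator D := by
      funext r
      simp [indicator]
    simp only [this]
    rw [setIntegral_indicator (measurableSet_lt measurable_const hw.measurable)]
    set S := Ioc (0:ℝ) 1 ∩ {r | t < w r} with hS
    rcases S.eq_empty_or_nonempty with h | h
    · simp [h]
    · have hb : BddAbove S := ⟨1, fun x hx => hx.1.2⟩
      have hα1 : sSup S ≤ 1 := csSup_le h (fun x hx => hx.1.2)
      have hα0 : 0 ≤ sSup S := by
        obtain ⟨x, hx⟩ := h
        exact hx.1.1.le.trans (le_csSup hb hx)
      have hsub : S ⊆ Ioc 0 (sSup S) := fun x hx => ⟨hx.1.1, le_csSup hb hx⟩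
      have hsub2 : Ioo 0 (sSup S) ⊆ S := by
        intro x hx
        obtain ⟨y, hy, hxy⟩ := exists_lt_of_lt_csSup h hx.2
        exact ⟨⟨hx.1, hx.2.le.trans hα1⟩, lt_of_lt_of_le hy.2 (hw hxy.le)⟩
      have hae : S =ᵐ[volume] Ioc 0 (sSup S) := by
        apply (HasSubset.Subset.eventuallyLE hsub).antisymm
        exact (Ioo_ae_eq_Ioc (μ := volume)).symm.le.trans (HasSubset.Subset.eventuallyLE hsub2)
      rw [setIntegral_congr_set hae, ← intervalIntegral.integral_of_le hα0]
      exact hpos _ ⟨hα0, hα1⟩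
  · have hi : Integrable (fun p : ℝ × ℝ => D p.1)
        ((volume.restrict (Ioc 0 1)).prod (volume.restrict (Ioc 0 M))) := hD.comp_fst _
    exact hi.indicator hms

section quant
variable (P : Measure Ω) [IsProbabilityMeasure P]

lemma qf_le_iff {U : Ω → ℝ} (hU : Measurable U) {a b : ℝ}
    (ha : ∀ᵐ ω ∂P, a ≤ U ω) (hb : ∀ᵐ ω ∂P, U ω ≤ b) {r : ℝ} (hr : r ∈ Ioc (0:ℝ) 1) (x : ℝ) :
    qf P U r ≤ x ↔ r ≤ (P {ω | U ω ≤ x}).toReal := by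
  haveI : IsProbabilityMeasure (P.map U) := Measure.isProbabilityMeasure_map hU.aemeasurable
  have hF : ∀ x, (P {ω | U ω ≤ x}).toReal = ProbabilityTheory.cdf (P.map U) x := by
    intro x
    rw [ProbabilityTheory.cdf_eq_real, measureReal_def, Measure.map_apply hU measurableSet_Iic]
    rfl
  have hne : {x : ℝ | r ≤ (P {ω | U ω ≤ x}).toReal}.Nonempty := by
    refine ⟨b, ?_⟩
    have : P {ω | U ω ≤ b} = 1 := by
      rw [← prob_compl_eq_zero_iff (measurableSet_le hU measurable_const)]
      exact hb
    simp [this, hr.2]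
  have hbd : BddBelow {x : ℝ | r ≤ (P {ω | U ω ≤ x}).toReal} := by
    refine ⟨a, fun x hx => ?_⟩
    by_contra hlt
    push Not at hlt
    have : P {ω | U ω ≤ x} = 0 := by
      refine measure_mono_null ?_ ha
      intro ω hω hcon
      have h1 : U ω ≤ x := hω
      have h2 : a ≤ U ω := hcon
      linarith
    simp only [mem_setOf_eq, this, ENNReal.toReal_zero] at hx
    linarith [hr.1]
  constructor
  · intro h
    have hx : ∀ y, x < y → r ≤ ProbabilityTheory.cdf (P.map U) y := by
      intro y hy
      obtain ⟨z, hz, hzy⟩ := exists_lt_of_csInf_lt hne (lt_of_le_of_lt h hy)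
      have hz' : r ≤ ProbabilityTheory.cdf (P.map U) z := by rw [← hF]; exact hz
      exact hz'.trans (ProbabilityTheory.monotone_cdf _ hzy.le)
    rw [hF]
    have hc := (ProbabilityTheory.cdf (P.map U)).right_continuous x
    have hc' : Tendsto (ProbabilityTheory.cdf (P.map U)) (nhdsWithin x (Ioi x))
        (nhds (ProbabilityTheory.cdf (P.map U) x)) := hc.mono_left (nhdsWithin_mono _ Ioi_subset_Ici_self)
    exact ge_of_tendsto hc' (eventually_nhdsWithin_of_forall hx)
  · intro h
    exact csInf_le hbd h

lemma qf_mem {U : Ω → ℝ} (hU : Measurable U) {a b : ℝ}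
    (ha : ∀ᵐ ω ∂P, a ≤ U ω) (hb : ∀ᵐ ω ∂P, U ω ≤ b) {r : ℝ} (hr : r ∈ Ioc (0:ℝ) 1) :
    qf P U r ∈ Icc a b := by
  constructor
  · by_contra hlt
    push Not at hlt
    have := (qf_le_iff P hU ha hb hr (qf P U r)).1 le_rfl
    have h0 : P {ω | U ω ≤ qf P U r} = 0 := by
      refine measure_mono_null ?_ ha
      intro ω hω hcon
      have h1 : U ω ≤ qf P U r := hω
      have h2 : a ≤ U ω := hcon
      linarith
    rw [h0] at this
    simp at this
    linarith [hr.1]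
  · rw [qf_le_iff P hU ha hb hr]
    have : P {ω | U ω ≤ b} = 1 := by
      rw [← prob_compl_eq_zero_iff (measurableSet_le hU measurable_const)]
      exact hb
    simp [this, hr.2]

lemma qf_monotoneOn {U : Ω → ℝ} (hU : Measurable U) {a b : ℝ}
    (ha : ∀ᵐ ω ∂P, a ≤ U ω) (hb : ∀ᵐ ω ∂P, U ω ≤ b) :
    MonotoneOn (qf P U) (Ioc 0 1) := by
  intro r hr s hs hrs
  rw [qf_le_iff P hU ha hb hr]
  exact hrs.trans ((qf_le_iff P hU ha hb hs _).1 le_rfl)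

lemma qf_aemeasurable {U : Ω → ℝ} (hU : Measurable U) {a b : ℝ}
    (ha : ∀ᵐ ω ∂P, a ≤ U ω) (hb : ∀ᵐ ω ∂P, U ω ≤ b) :
    AEMeasurable (qf P U) (volume.restrict (Ioc 0 1)) :=
  aemeasurable_restrict_of_monotoneOn measurableSet_Ioc (qf_monotoneOn P hU ha hb)

lemma qf_integrableOn {U : Ω → ℝ} (hU : Measurable U) {a b : ℝ}
    (ha : ∀ᵐ ω ∂P, a ≤ U ω) (hb : ∀ᵐ ω ∂P, U ω ≤ b) :
    IntegrableOn (qf P U) (Ioc 0 1) := by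
  refine Integrable.of_bound (qf_aemeasurable P hU ha hb).aestronglyMeasurable (max |a| |b|) ?_
  filter_upwards [ae_restrict_mem measurableSet_Ioc] with r hr
  have := qf_mem P hU ha hb hr
  exact abs_le_max_abs_abs this.1 this.2

lemma map_qf {U : Ω → ℝ} (hU : Measurable U) {a b : ℝ}
    (ha : ∀ᵐ ω ∂P, a ≤ U ω) (hb : ∀ᵐ ω ∂P, U ω ≤ b) :
    (volume.restrict (Ioc (0:ℝ) 1)).map (qf P U) = P.map U := by
  have hm := qf_aemeasurable P hU ha hb
  haveI : IsProbabilityMeasure (volume.restrict (Ioc (0:ℝ) 1)) := ⟨by simp⟩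
  haveI : IsProbabilityMeasure ((volume.restrict (Ioc (0:ℝ) 1)).map (qf P U)) :=
    Measure.isProbabilityMeasure_map hm
  refine Measure.ext_of_Iic _ _ fun x => ?_
  rw [Measure.map_apply hU measurableSet_Iic, Measure.map_apply_of_aemeasurable hm measurableSet_Iic]
  have h1 : (P {ω | U ω ≤ x}).toReal ≤ 1 := by
    have := prob_le_one (μ := P) (s := {ω | U ω ≤ x})
    exact ENNReal.toReal_mono ENNReal.one_ne_top this
  rw [Measure.restrict_apply' measurableSet_Ioc]
  have hs : qf P U ⁻¹' Iic x ∩ Ioc 0 1 = Ioc 0 (P {ω | U ω ≤ x}).toReal := by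
    ext r
    simp only [mem_inter_iff, mem_preimage, mem_Iic]
    constructor
    · rintro ⟨h, hr⟩
      exact ⟨hr.1, (qf_le_iff P hU ha hb hr x).1 h⟩
    · rintro ⟨h, hr⟩
      have : r ∈ Ioc (0:ℝ) 1 := ⟨h, hr.trans h1⟩
      exact ⟨(qf_le_iff P hU ha hb this x).2 hr, this⟩
  rw [hs]
  simp only [Real.volume_Ioc, sub_zero]
  rw [ENNReal.ofReal_toReal (measure_ne_top _ _)]
  rfl

lemma integral_qf {U : Ω → ℝ} (hU : Measurable U) {a b : ℝ}
    (ha : ∀ᵐ ω ∂P, a ≤ U ω) (hb : ∀ᵐ ω ∂P, U ω ≤ b) (f : ℝ → ℝ) (hf : Measurable f) :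
    ∫ ω, f (U ω) ∂P = ∫ r in Ioc (0:ℝ) 1, f (qf P U r) := by
  rw [← integral_map hU.aemeasurable hf.aestronglyMeasurable, ← map_qf P hU ha hb,
    integral_map (qf_aemeasurable P hU ha hb) hf.aestronglyMeasurable]

lemma integrable_qf {U : Ω → ℝ} (hU : Measurable U) {a b : ℝ}
    (ha : ∀ᵐ ω ∂P, a ≤ U ω) (hb : ∀ᵐ ω ∂P, U ω ≤ b) (f : ℝ → ℝ) (hf : Measurable f)
    (hi : Integrable (fun ω => f (U ω)) P) : IntegrableOn (fun r => f (qf P U r)) (Ioc 0 1) := by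
  have := (integrable_map_measure (μ := P) (f := U) (g := f)
    hf.aestronglyMeasurable hU.aemeasurable).2 hi
  rw [← map_qf P hU ha hb] at this
  exact (integrable_map_measure hf.aestronglyMeasurable (qf_aemeasurable P hU ha hb)).1 this

/-- lower bound of variational formula -/
lemma int_qf_ge {U : Ω → ℝ} (hU : Measurable U) {a b : ℝ}
    (ha : ∀ᵐ ω ∂P, a ≤ U ω) (hb : ∀ᵐ ω ∂P, U ω ≤ b) {α : ℝ} (hα : α ∈ Icc (0:ℝ) 1) (k : ℝ) :
    k * α - ∫ ω, max (k - U ω) 0 ∂P ≤ ∫ r in (0:ℝ)..α, qf P U r := by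
  have hq := qf_integrableOn P hU ha hb
  have hsub : Ioc 0 α ⊆ Ioc (0:ℝ) 1 := Ioc_subset_Ioc_right hα.2
  have hm : Measurable (fun t : ℝ => max (k - t) 0) := by fun_prop
  have hmi : IntegrableOn (fun r => max (k - qf P U r) 0) (Ioc 0 1) := by
    have h1 : IntegrableOn (fun r => k - qf P U r) (Ioc 0 1) :=
      (integrable_const k).sub hq
    exact h1.pos_part
  rw [integral_qf P hU ha hb (fun t => max (k - t) 0) hm, intervalIntegral.integral_of_le hα.1]
  have h1 : ∫ r in Ioc 0 α, max (k - qf P U r) 0 ≤ ∫ r in Ioc 0 1, max (k - qf P U r) 0 := by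
    refine setIntegral_mono_set hmi ?_ hsub.eventuallyLE
    exact Eventually.of_forall fun r => le_max_right _ _
  have h2 : ∫ r in Ioc 0 α, (k - max (k - qf P U r) 0) ≤ ∫ r in Ioc 0 α, qf P U r := by
    refine integral_mono ?_ (hq.mono_set hsub) ?_
    · exact (integrable_const k).sub (hmi.mono_set hsub)
    · intro r
      have := le_max_left (k - qf P U r) 0
      simp only
      linarith
  rw [integral_sub (integrable_const k) (hmi.mono_set hsub)] at h2
  simp only [integral_const, measureReal_restrict_apply_univ, Real.volume_real_Ioc_of_le hα.1,
    smul_eq_mul, sub_zero] at h2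
  linarith

lemma int_qf_eq {U : Ω → ℝ} (hU : Measurable U) {a b : ℝ}
    (ha : ∀ᵐ ω ∂P, a ≤ U ω) (hb : ∀ᵐ ω ∂P, U ω ≤ b) {α : ℝ} (hα : α ∈ Ioc (0:ℝ) 1) :
    ∫ r in (0:ℝ)..α, qf P U r = qf P U α * α - ∫ ω, max (qf P U α - U ω) 0 ∂P := by
  set k := qf P U α with hk
  have hq := qf_integrableOn P hU ha hb
  have hmo := qf_monotoneOn P hU ha hb
  have hsub : Ioc 0 α ⊆ Ioc (0:ℝ) 1 := Ioc_subset_Ioc_right hα.2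
  have hm : Measurable (fun t : ℝ => max (k - t) 0) := by fun_prop
  rw [integral_qf P hU ha hb (fun t => max (k - t) 0) hm, intervalIntegral.integral_of_le hα.1.le]
  have h1 : ∫ r in Ioc 0 1, max (k - qf P U r) 0 =
      ∫ r in Ioc 0 1, (Ioc 0 α).indicator (fun r => k - qf P U r) r := by
    refine setIntegral_congr_fun measurableSet_Ioc ?_
    intro r hr
    by_cases h : r ≤ α
    · have : qf P U r ≤ k := hmo hr hα h
      simp only [indicator, mem_Ioc, hr.1, h, and_self, if_true]
      exact max_eq_left (by linarith)
    · have : k ≤ qf P U r := hmo hα hr (le_of_not_ge h)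
      simp only [indicator, mem_Ioc, h, and_false, if_false]
      exact max_eq_right (by linarith)
  rw [h1, setIntegral_indicator measurableSet_Ioc, inter_eq_right.2 hsub,
    integral_sub (integrable_const k) (hq.mono_set hsub)]
  simp only [integral_const, measureReal_restrict_apply_univ, Real.volume_real_Ioc_of_le hα.1.le,
    smul_eq_mul, sub_zero]
  ring

/-- stop-loss order implies ES order -/
lemma ES_le_of_stoploss {U V : Ω → ℝ} (hU : Measurable U) (hV : Measurable V) {a b : ℝ}
    (ha : ∀ᵐ ω ∂P, a ≤ U ω) (hb : ∀ᵐ ω ∂P, U ω ≤ b)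
    (ha' : ∀ᵐ ω ∂P, a ≤ V ω) (hb' : ∀ᵐ ω ∂P, V ω ≤ b)
    (h : ∀ k : ℝ, ∫ ω, max (k - V ω) 0 ∂P ≤ ∫ ω, max (k - U ω) 0 ∂P)
    {p : ℝ} (hp : p ∈ Icc (0:ℝ) 1) : ES P p V ≤ ES P p U := by
  unfold ES
  split_ifs with h1
  · have hα : 1 - p ∈ Ioc (0:ℝ) 1 := ⟨by linarith, by linarith [hp.1]⟩
    have e1 := int_qf_eq P hU ha hb hα
    have e2 := int_qf_ge P hV ha' hb' ⟨hα.1.le, hα.2⟩ (qf P U (1 - p))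
    have e3 := h (qf P U (1 - p))
    have : 0 < 1 / (1 - p) := one_div_pos.2 hα.1
    nlinarith
  · unfold rhoW
    refine csInf_le_csInf ?_ ?_ ?_
    · refine ⟨-b, fun m hm => ?_⟩
      obtain ⟨ω, h2, h3⟩ := (hb'.and hm).exists
      linarith
    · refine ⟨-a, ?_⟩
      filter_upwards [ha] with ω hω
      linarith
    · intro m hm
      have hz : ∫ ω, max (-m - U ω) 0 ∂P = 0 := by
        apply integral_eq_zero_of_ae
        filter_upwards [hm] with ω hω
        exact max_eq_right (by linarith)
      have h2 := h (-m)
      rw [hz] at h2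
      have hi : Integrable (fun ω => max (-m - V ω) 0) P := by
        have : Integrable V P := by
          refine Integrable.of_bound hV.aestronglyMeasurable (max |a| |b|) ?_
          filter_upwards [ha', hb'] with ω h1 h2
          exact abs_le_max_abs_abs h1 h2
        have h3 : Integrable (fun ω => -m - V ω) P := (integrable_const _).sub this
        exact h3.pos_part
      have hnn : 0 ≤ fun ω => max (-m - V ω) 0 := fun ω => le_max_right _ _
      have h4 := (integral_eq_zero_iff_of_nonneg hnn hi).1
        (le_antisymm h2 (integral_nonneg hnn))
      filter_upwards [h4] with ω hω
      have h5 := le_max_left (-m - V ω) 0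
      have h6 : max (-m - V ω) 0 = 0 := hω
      linarith

lemma ES_bounds {U : Ω → ℝ} (hU : Measurable U) {a b : ℝ}
    (ha : ∀ᵐ ω ∂P, a ≤ U ω) (hb : ∀ᵐ ω ∂P, U ω ≤ b) {p : ℝ} (hp : p ∈ Icc (0:ℝ) 1) :
    ES P p U ∈ Icc (-b) (-a) := by
  unfold ES
  split_ifs with h1
  · have hα : 1 - p ∈ Ioc (0:ℝ) 1 := ⟨by linarith, by linarith [hp.1]⟩
    have hsub : Ioc 0 (1 - p) ⊆ Ioc (0:ℝ) 1 := Ioc_subset_Ioc_right hα.2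
    have hq := (qf_integrableOn P hU ha hb).mono_set hsub
    rw [intervalIntegral.integral_of_le hα.1.le]
    have l : ∫ r in Ioc 0 (1 - p), a ≤ ∫ r in Ioc 0 (1 - p), qf P U r :=
      setIntegral_mono_on (integrable_const a) hq measurableSet_Ioc
        (fun r hr => (qf_mem P hU ha hb (hsub hr)).1)
    have u : ∫ r in Ioc 0 (1 - p), qf P U r ≤ ∫ r in Ioc 0 (1 - p), b :=
      setIntegral_mono_on hq (integrable_const b) measurableSet_Ioc
        (fun r hr => (qf_mem P hU ha hb (hsub hr)).2)
    simp only [integral_const, measureReal_restrict_apply_univ, Real.volume_real_Ioc_of_le hα.1.le,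
      smul_eq_mul, sub_zero] at l u
    rw [neg_mul, one_div, inv_mul_eq_div]
    constructor
    · rw [neg_le_neg_iff, div_le_iff₀ hα.1]; linarith
    · rw [neg_le_neg_iff, le_div_iff₀ hα.1]; linarith
  · unfold rhoW
    have hl : ∀ m ∈ {m : ℝ | ∀ᵐ ω ∂P, -U ω ≤ m}, -b ≤ m := by
      intro m hm
      obtain ⟨ω, h2, h3⟩ := (hb.and hm).exists
      linarith
    have hmem : -a ∈ {m : ℝ | ∀ᵐ ω ∂P, -U ω ≤ m} := by
      filter_upwards [ha] with ω hω
      linarith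
    exact ⟨le_csInf ⟨_, hmem⟩ hl, csInf_le ⟨_, hl⟩ hmem⟩

lemma ES_mono {U : Ω → ℝ} (hU : Measurable U) {a b : ℝ}
    (ha : ∀ᵐ ω ∂P, a ≤ U ω) (hb : ∀ᵐ ω ∂P, U ω ≤ b) :
    MonotoneOn (fun p => ES P p U) (Icc 0 1) := by
  intro p hp s hs hps
  simp only
  by_cases h1 : s < 1
  · have hp1 : p < 1 := lt_of_le_of_lt hps h1
    unfold ES
    rw [if_pos h1, if_pos hp1]
    have hα : 1 - s ∈ Ioc (0:ℝ) 1 := ⟨by linarith, by linarith [hs.1]⟩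
    have hβ : 1 - p ∈ Ioc (0:ℝ) 1 := ⟨by linarith, by linarith [hp.1]⟩
    set α := 1 - s
    set β := 1 - p
    have hαβ : α ≤ β := by simp only [α, β]; linarith
    have hq := qf_integrableOn P hU ha hb
    have hmo := qf_monotoneOn P hU ha hb
    have hsub : Ioc 0 α ⊆ Ioc (0:ℝ) 1 := Ioc_subset_Ioc_right hα.2
    have hsub2 : Ioc α β ⊆ Ioc (0:ℝ) 1 := Ioc_subset_Ioc hα.1.le hβ.2
    have hsplit : ∫ r in (0:ℝ)..β, qf P U r =
        (∫ r in (0:ℝ)..α, qf P U r) + ∫ r in α..β, qf P U r := by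
      rw [intervalIntegral.integral_add_adjacent_intervals]
      · rw [intervalIntegrable_iff_integrableOn_Ioc_of_le hα.1.le]; exact hq.mono_set hsub
      · rw [intervalIntegrable_iff_integrableOn_Ioc_of_le hαβ]; exact hq.mono_set hsub2
    have u : ∫ r in (0:ℝ)..α, qf P U r ≤ qf P U α * α := by
      rw [intervalIntegral.integral_of_le hα.1.le]
      have := setIntegral_mono_on (hq.mono_set hsub) (integrable_const (qf P U α))
        measurableSet_Ioc (fun r hr => hmo (hsub hr) hα hr.2)
      simp only [integral_const, measureReal_restrict_apply_univ,
        Real.volume_real_Ioc_of_le hα.1.le, smul_eq_mul, sub_zero] at this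
      linarith
    have l : qf P U α * (β - α) ≤ ∫ r in α..β, qf P U r := by
      rw [intervalIntegral.integral_of_le hαβ]
      have := setIntegral_mono_on (integrable_const (qf P U α)) (hq.mono_set hsub2)
        measurableSet_Ioc (fun r hr => hmo hα (hsub2 hr) hr.1.le)
      simp only [integral_const, measureReal_restrict_apply_univ,
        Real.volume_real_Ioc_of_le hαβ, smul_eq_mul] at this
      linarith
    rw [neg_mul, neg_mul, neg_le_neg_iff, one_div, one_div, inv_mul_eq_div, inv_mul_eq_div,
      div_le_div_iff₀ hα.1 hβ.1, hsplit]
    have k1 := mul_le_mul_of_nonneg_left u (sub_nonneg.2 hαβ)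
    have k2 := mul_le_mul_of_nonneg_left l hα.1.le
    nlinarith
  · have hs1 : ES P s U = rhoW P U := by unfold ES; rw [if_neg h1]
    rw [hs1]
    unfold rhoW
    refine le_csInf ⟨-a, ?_⟩ ?_
    · filter_upwards [ha] with ω hω
      linarith
    · intro m hm
      have : ∀ᵐ ω ∂P, -m ≤ U ω := by
        filter_upwards [hm] with ω hω
        linarith
      have := (ES_bounds P hU this hb hp).2
      linarith

lemma ES_scale (U : Ω → ℝ) {t : ℝ} (ht : 0 < t) (p : ℝ) :
    ES P p (fun ω => t * U ω) = t * ES P p U := by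
  have hq : ∀ r, qf P (fun ω => t * U ω) r = t * qf P U r := by
    intro r
    unfold qf
    rw [← smul_eq_mul, ← Real.sInf_smul_of_nonneg ht.le]
    congr 1
    ext x
    rw [mem_smul_set_iff_inv_smul_mem₀ ht.ne']
    simp only [mem_setOf_eq, smul_eq_mul]
    have : {ω | t * U ω ≤ x} = {ω | U ω ≤ t⁻¹ * x} := by
      ext ω
      simp only [mem_setOf_eq]
      rw [inv_mul_eq_div, le_div_iff₀ ht, mul_comm]
    rw [this]
  unfold ES
  split_ifs
  · simp only [hq, intervalIntegral.integral_const_mul]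
    ring
  · unfold rhoW
    rw [← smul_eq_mul, ← Real.sInf_smul_of_nonneg ht.le]
    congr 1
    ext x
    rw [mem_smul_set_iff_inv_smul_mem₀ ht.ne']
    simp only [mem_setOf_eq, smul_eq_mul]
    have : ∀ ω, -(t * U ω) ≤ x ↔ - U ω ≤ t⁻¹ * x := by
      intro ω
      rw [inv_mul_eq_div, le_div_iff₀ ht]
      constructor <;> intro h <;> linarith
    simp only [this]

end quant

lemma hasDeriv_v (c x : ℝ) : HasDerivAt (fun x => -Real.exp (c * x)) (-c * Real.exp (c * x)) x := by
  have := (((hasDerivAt_id x).const_mul c).exp).neg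
  exact this.congr_deriv (by simp only [id]; ring)

lemma deriv_v (c : ℝ) : deriv (fun x => -Real.exp (c * x)) = fun x => -c * Real.exp (c * x) :=
  funext fun x => (hasDeriv_v c x).deriv

lemma hasDeriv_v' (c x : ℝ) :
    HasDerivAt (fun x => -c * Real.exp (c * x)) (-c * (c * Real.exp (c * x))) x := by
  have := (((hasDerivAt_id x).const_mul c).exp).const_mul (-c)
  exact this.congr_deriv (by simp only [id]; ring)

lemma RA_v (c : ℝ) (hc : c < 0) (x : ℝ) : RA (fun x => -Real.exp (c * x)) x = -c := by
  unfold RA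
  rw [deriv_v, (hasDeriv_v' c x).deriv]
  have := Real.exp_pos (c * x)
  field_simp

section cmp
variable (P : Measure Ω) [IsProbabilityMeasure P]

lemma integrable_comp_of_continuous {X : Ω → ℝ} (hX : MemX P X) {u : ℝ → ℝ} (hu : Continuous u) :
    Integrable (fun ω => u (X ω)) P := by
  obtain ⟨hm, C, hC⟩ := hX
  obtain ⟨K, hK⟩ := (isCompact_Icc (a := -C) (b := C)).exists_bound_of_continuousOn hu.continuousOn
  refine Integrable.of_bound (hu.measurable.comp hm).aestronglyMeasurable K ?_
  filter_upwards [hC] with ω hω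
  exact hK _ (abs_le.1 hω)

lemma vSD_comp {c : ℝ} (hc : c < 0) {X Y : Ω → ℝ} (hX : MemX P X) (hY : MemX P Y)
    (h : vSD P Set.univ (fun x => -Real.exp (c * x)) X Y) (f f1 f2 : ℝ → ℝ)
    (hf : ∀ t, HasDerivAt f (f1 t) t) (hf1 : ∀ t, HasDerivAt f1 (f2 t) t)
    (hpos : ∀ t, 0 < f1 t) (hneg : ∀ t, f2 t ≤ 0) :
    ∫ ω, f (-Real.exp (c * X ω)) ∂P ≤ ∫ ω, f (-Real.exp (c * Y ω)) ∂P := by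
  have d1 : ∀ x, HasDerivAt (fun x => f (-Real.exp (c * x)))
      (f1 (-Real.exp (c * x)) * (-c * Real.exp (c * x))) x :=
    fun x => (hf _).comp x (hasDeriv_v c x)
  have e1 : deriv (fun x => f (-Real.exp (c * x))) =
      fun x => f1 (-Real.exp (c * x)) * (-c * Real.exp (c * x)) := funext fun x => (d1 x).deriv
  have d2 : ∀ x, HasDerivAt (fun x => f1 (-Real.exp (c * x)) * (-c * Real.exp (c * x)))
      (f2 (-Real.exp (c * x)) * (-c * Real.exp (c * x)) * (-c * Real.exp (c * x)) +
        f1 (-Real.exp (c * x)) * (-c * (c * Real.exp (c * x)))) x := by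
    intro x
    have k : HasDerivAt (fun x => f1 (-Real.exp (c * x)))
      (f2 (-Real.exp (c * x)) * (-c * Real.exp (c * x))) x := (hf1 _).comp x (hasDeriv_v c x)
    exact k.mul (hasDeriv_v' c x)
  have vpos : ∀ x, 0 < -c * Real.exp (c * x) := fun x => mul_pos (by linarith) (Real.exp_pos _)
  have hcont : Continuous (fun x => f (-Real.exp (c * x))) :=
    continuous_iff_continuousAt.2 fun x => (d1 x).continuousAt
  refine h (fun x => f (-Real.exp (c * x))) ⟨fun x _ => (d1 x).differentiableAt, ?_, ?_⟩ ?_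
    (integrable_comp_of_continuous P hX hcont) (integrable_comp_of_continuous P hY hcont)
  · intro x _
    rw [e1]
    exact (d2 x).differentiableAt
  · intro x _
    rw [e1]
    exact mul_pos (hpos _) (vpos x)
  · intro x _
    rw [RA_v c hc]
    unfold RA
    rw [e1, (d2 x).deriv, le_div_iff₀ (mul_pos (hpos _) (vpos x))]
    have := mul_nonneg (neg_nonneg.2 (hneg (-Real.exp (c * x)))) (mul_pos (vpos x) (vpos x)).le
    nlinarith

lemma stoploss_of_vSD {c : ℝ} (hc : c < 0) {X Y : Ω → ℝ} (hX : MemX P X) (hY : MemX P Y)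
    (h : vSD P Set.univ (fun x => -Real.exp (c * x)) X Y) (k : ℝ) :
    ∫ ω, max (k - -Real.exp (c * Y ω)) 0 ∂P ≤ ∫ ω, max (k - -Real.exp (c * X ω)) 0 ∂P := by
  refine le_of_forall_pos_le_add fun ε hε => ?_
  set s : ℝ → ℝ := fun t => Real.sqrt ((k - t) ^ 2 + ε ^ 2) with hs
  have spos : ∀ t, 0 < s t := fun t => Real.sqrt_pos.2 (by positivity)
  have ssq : ∀ t, s t ^ 2 = (k - t) ^ 2 + ε ^ 2 := fun t => Real.sq_sqrt (by positivity)
  have ds : ∀ t, HasDerivAt s (-(k - t) / s t) t := by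
    intro t
    have d0 : HasDerivAt (fun t : ℝ => (k - t) ^ 2 + ε ^ 2) (2 * (k - t) * (-1)) t := by
      have := (((hasDerivAt_id t).const_sub k).pow 2).add_const (ε ^ 2)
      exact this.congr_deriv (by simp)
    have := d0.sqrt (by positivity)
    refine this.congr_deriv ?_
    change _ / (2 * s t) = _
    have := (spos t).ne'
    field_simp
  have slt : ∀ t, |k - t| < s t := by
    intro t
    apply abs_lt_of_sq_lt_sq _ (spos t).le
    rw [ssq]
    have : 0 < ε ^ 2 := by positivity
    linarith
  have slt2 : ∀ t, s t ≤ |k - t| + ε := by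
    intro t
    apply le_of_sq_le_sq _ (by positivity)
    rw [ssq]
    have := mul_nonneg (abs_nonneg (k - t)) hε.le
    have := sq_abs (k - t)
    nlinarith
  have key := vSD_comp P hc hX hY h (fun t => -((k - t) + s t) / 2)
    (fun t => (1 + (k - t) / s t) / 2)
    (fun t => ((-1) * s t - (k - t) * (-(k - t) / s t)) / (s t) ^ 2 / 2) ?_ ?_ ?_ ?_
  · have hc1 : Continuous s := by simp only [hs]; fun_prop
    have iY : Integrable (fun ω => -((k - -Real.exp (c * Y ω)) + s (-Real.exp (c * Y ω))) / 2) P :=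
      integrable_comp_of_continuous P hY
        (u := fun x => -((k - -Real.exp (c * x)) + s (-Real.exp (c * x))) / 2) (by fun_prop)
    have iX : Integrable (fun ω => -((k - -Real.exp (c * X ω)) + s (-Real.exp (c * X ω))) / 2) P :=
      integrable_comp_of_continuous P hX
        (u := fun x => -((k - -Real.exp (c * x)) + s (-Real.exp (c * x))) / 2) (by fun_prop)
    have jY : Integrable (fun ω => max (k - -Real.exp (c * Y ω)) 0) P :=
      integrable_comp_of_continuous P hY (u := fun x => max (k - -Real.exp (c * x)) 0) (by fun_prop)
    have jX : Integrable (fun ω => max (k - -Real.exp (c * X ω)) 0) P :=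
      integrable_comp_of_continuous P hX (u := fun x => max (k - -Real.exp (c * x)) 0) (by fun_prop)
    have l1 : ∫ ω, max (k - -Real.exp (c * Y ω)) 0 ∂P ≤
        ∫ ω, -(-((k - -Real.exp (c * Y ω)) + s (-Real.exp (c * Y ω))) / 2) ∂P := by
      refine integral_mono jY iY.neg fun ω => ?_
      have h1 := slt (-Real.exp (c * Y ω))
      have h2 := le_abs_self (k - -Real.exp (c * Y ω))
      have h3 := neg_le_abs (k - -Real.exp (c * Y ω))
      simp only
      apply max_le <;> linarith
    have l2 : ∫ ω, -(-((k - -Real.exp (c * X ω)) + s (-Real.exp (c * X ω))) / 2) ∂P ≤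
        ∫ ω, (max (k - -Real.exp (c * X ω)) 0 + ε) ∂P := by
      refine integral_mono iX.neg (jX.add (integrable_const ε)) fun ω => ?_
      have h1 := slt2 (-Real.exp (c * X ω))
      simp only
      rcases le_total 0 (k - -Real.exp (c * X ω)) with h2 | h2
      · rw [abs_of_nonneg h2] at h1
        rw [max_eq_left h2]; linarith
      · rw [abs_of_nonpos h2] at h1
        rw [max_eq_right h2]; linarith
    rw [integral_neg] at l1 l2
    rw [integral_add jX (integrable_const ε)] at l2
    simp only [integral_const, probReal_univ, smul_eq_mul, one_mul] at l2
    linarith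
  · intro t
    have := ((((hasDerivAt_id t).const_sub k).add (ds t)).neg).div_const 2
    exact this.congr_deriv (by ring)
  · intro t
    have := ((((hasDerivAt_id t).const_sub k).div (ds t) (spos t).ne').const_add 1).div_const 2
    exact this
  · intro t
    have h1 := abs_lt.1 (slt t)
    have : -1 < (k - t) / s t := by rw [lt_div_iff₀ (spos t)]; linarith
    linarith
  · intro t
    have e : ((-1) * s t - (k - t) * (-(k - t) / s t)) / (s t) ^ 2 / 2 =
        - (ε ^ 2 / (s t) ^ 3 / 2) := by
      have := (spos t).ne'
      have h2 := ssq t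
      field_simp
      linarith
    simp only [e]
    have := spos t
    have : 0 ≤ ε ^ 2 / (s t) ^ 3 / 2 := by positivity
    linarith

lemma vSD_of_ES {c : ℝ} (hc : c < 0) {X Y : Ω → ℝ} (hX : MemX P X) (hY : MemX P Y)
    (h : ∀ p ∈ Ico (0:ℝ) 1, ES P p (fun ω => -Real.exp (c * Y ω)) ≤
      ES P p (fun ω => -Real.exp (c * X ω))) :
    vSD P Set.univ (fun x => -Real.exp (c * x)) X Y := by
  intro u hu hRA iX iY
  obtain ⟨u1, u2, u3⟩ := hu
  have ucont : Continuous u := continuous_iff_continuousAt.2 fun x => (u1 x trivial).continuousAt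
  -- the weight
  set w : ℝ → ℝ := fun x => deriv u x * Real.exp (-(c * x)) / (-c) with hw
  have dw : ∀ x, HasDerivAt w ((deriv (deriv u) x - c * deriv u x) * Real.exp (-(c * x)) / (-c)) x := by
    intro x
    have e : HasDerivAt (fun x => Real.exp (-(c * x))) (Real.exp (-(c * x)) * (-(c * 1))) x :=
      (((hasDerivAt_id x).const_mul c).neg).exp
    have := (((u2 x trivial).hasDerivAt).mul e).div_const (-c)
    exact this.congr_deriv (by ring)
  have wanti : Antitone w := by
    refine antitone_of_deriv_nonpos (fun x => (dw x).differentiableAt) fun x => ?_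
    rw [(dw x).deriv]
    have h1 := hRA x trivial
    rw [RA_v c hc] at h1
    unfold RA at h1
    rw [le_div_iff₀ (u3 x trivial)] at h1
    have h2 : deriv (deriv u) x - c * deriv u x ≤ 0 := by linarith
    exact div_nonpos_of_nonpos_of_nonneg
      (mul_nonpos_of_nonpos_of_nonneg h2 (Real.exp_pos _).le) (by linarith)
  have wpos : ∀ x, 0 ≤ w x := fun x =>
    div_nonneg (mul_nonneg (u3 x trivial).le (Real.exp_pos _).le) (by linarith)
  have wv : ∀ x, w x * (-c * Real.exp (c * x)) = deriv u x := by
    intro x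
    simp only [hw]
    rw [Real.exp_neg]
    have := (Real.exp_pos (c * x)).ne'
    have hcn := hc.ne
    field_simp
  have key : ∀ x y, w y * (-Real.exp (c * y) - -Real.exp (c * x)) ≤ u y - u x := by
    intro x y
    set φ : ℝ → ℝ := fun x => u x - w y * (-Real.exp (c * x)) with hφ
    have dφ : ∀ x, HasDerivAt φ ((w x - w y) * (-c * Real.exp (c * x))) x := by
      intro x
      have := ((u1 x trivial).hasDerivAt).sub ((hasDeriv_v c x).const_mul (w y))
      exact this.congr_deriv (by rw [← wv x]; ring)
    have vpos : ∀ x, 0 ≤ -c * Real.exp (c * x) :=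
      fun x => (mul_pos (by linarith) (Real.exp_pos _)).le
    have hcont : Continuous φ := continuous_iff_continuousAt.2 fun x => (dφ x).continuousAt
    suffices φ x ≤ φ y by
      simp only [hφ] at this
      linarith
    rcases le_total x y with hxy | hxy
    · have : MonotoneOn φ (Iic y) := by
        refine monotoneOn_of_deriv_nonneg (convex_Iic y) hcont.continuousOn
          (fun z _ => (dφ z).differentiableAt.differentiableWithinAt) fun z hz => ?_
        rw [interior_Iic] at hz
        rw [(dφ z).deriv]
        exact mul_nonneg (sub_nonneg.2 (wanti (le_of_lt hz))) (vpos z)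
      exact this hxy (le_refl y) hxy
    · have : AntitoneOn φ (Ici y) := by
        refine antitoneOn_of_deriv_nonpos (convex_Ici y) hcont.continuousOn
          (fun z _ => (dφ z).differentiableAt.differentiableWithinAt) fun z hz => ?_
        rw [interior_Ici] at hz
        rw [(dφ z).deriv]
        exact mul_nonpos_of_nonpos_of_nonneg (sub_nonpos.2 (wanti (le_of_lt hz))) (vpos z)
      exact this (le_refl y) hxy hxy
  -- inverse of v
  set ℓ : ℝ → ℝ := fun t => Real.log (-t) / c with hℓ
  have hℓv : ∀ x, ℓ (-Real.exp (c * x)) = x := by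
    intro x
    simp only [hℓ, neg_neg, Real.log_exp]
    exact mul_div_cancel_left₀ x hc.ne
  have hvℓ : ∀ t, t < 0 → -Real.exp (c * ℓ t) = t := by
    intro t ht
    simp only [hℓ]
    rw [mul_div_cancel₀ _ hc.ne, Real.exp_log (by linarith)]
    ring
  have hℓmono : ∀ s t, s ≤ t → t < 0 → ℓ s ≤ ℓ t := by
    intro s t hst ht
    simp only [hℓ]
    apply div_le_div_of_nonpos_of_le hc.le
    exact Real.log_le_log (by linarith) (by linarith)
  have hℓm : Measurable ℓ := by simp only [hℓ]; fun_prop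
  obtain ⟨mX, CX, hCX⟩ := hX
  obtain ⟨mY, CY, hCY⟩ := hY
  set U : Ω → ℝ := fun ω => -Real.exp (c * X ω) with hU
  set V : Ω → ℝ := fun ω => -Real.exp (c * Y ω) with hV
  have mU : Measurable U := by simp only [hU]; fun_prop
  have mV : Measurable V := by simp only [hV]; fun_prop
  have aU : ∀ᵐ ω ∂P, -Real.exp (c * (-CX)) ≤ U ω := by
    filter_upwards [hCX] with ω hω
    have := (abs_le.1 hω).1
    simp only [hU]
    rw [neg_le_neg_iff, Real.exp_le_exp]; nlinarith
  have bU : ∀ᵐ ω ∂P, U ω ≤ -Real.exp (c * CX) := by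
    filter_upwards [hCX] with ω hω
    have := (abs_le.1 hω).2
    simp only [hU]
    rw [neg_le_neg_iff, Real.exp_le_exp]; nlinarith
  have aV : ∀ᵐ ω ∂P, -Real.exp (c * (-CY)) ≤ V ω := by
    filter_upwards [hCY] with ω hω
    have := (abs_le.1 hω).1
    simp only [hV]
    rw [neg_le_neg_iff, Real.exp_le_exp]; nlinarith
  have bV : ∀ᵐ ω ∂P, V ω ≤ -Real.exp (c * CY) := by
    filter_upwards [hCY] with ω hω
    have := (abs_le.1 hω).2
    simp only [hV]
    rw [neg_le_neg_iff, Real.exp_le_exp]; nlinarith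
  have nU : ∀ r ∈ Ioc (0:ℝ) 1, qf P U r < 0 := fun r hr =>
    lt_of_le_of_lt (qf_mem P mU aU bU hr).2 (neg_lt_zero.2 (Real.exp_pos _))
  have nV : ∀ r ∈ Ioc (0:ℝ) 1, qf P V r < 0 := fun r hr =>
    lt_of_le_of_lt (qf_mem P mV aV bV hr).2 (neg_lt_zero.2 (Real.exp_pos _))
  have mh : Measurable (fun t => u (ℓ t)) := ucont.measurable.comp hℓm
  have eX : (fun ω => u (X ω)) = fun ω => u (ℓ (U ω)) := by
    funext ω; simp only [hU, hℓv]
  have eY : (fun ω => u (Y ω)) = fun ω => u (ℓ (V ω)) := by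
    funext ω; simp only [hV, hℓv]
  rw [eX] at iX ⊢
  rw [eY] at iY ⊢
  have jX := integrable_qf P mU aU bU _ mh iX
  have jY := integrable_qf P mV aV bV _ mh iY
  rw [integral_qf P mU aU bU _ mh, integral_qf P mV aV bV _ mh, ← sub_nonneg, ← integral_sub jY jX]
  -- weight extension
  have qanti : AntitoneOn (fun r => w (ℓ (qf P V r))) (Ioc 0 1) := by
    intro r hr s hs hrs
    exact wanti (hℓmono _ _ (qf_monotoneOn P mV aV bV hr hs hrs) (nV s hs))
  have qbd : ∀ r ∈ Ioc (0:ℝ) 1, w (ℓ (qf P V r)) ≤ w (-CY) := by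
    intro r hr
    apply wanti
    rw [← hℓv (-CY)]
    exact hℓmono _ _ (qf_mem P mV aV bV hr).1 (nV r hr)
  obtain ⟨W, hW, hWeq⟩ := qanti.exists_antitone_extension
    ⟨0, by rintro _ ⟨r, hr, rfl⟩; exact wpos _⟩
    ⟨w (-CY), by rintro _ ⟨r, hr, rfl⟩; exact qbd r hr⟩
  have qU := qf_integrableOn P mU aU bU
  have qV := qf_integrableOn P mV aV bV
  have hD : IntegrableOn (fun r => qf P V r - qf P U r) (Ioc 0 1) := qV.sub qU
  have main := weight_nonneg W (fun r => qf P V r - qf P U r) (w (-CY)) hW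
    (fun r hr => by rw [← hWeq hr]; exact wpos _)
    (fun r hr => by rw [← hWeq hr]; exact qbd r hr) hD ?_
  · refine main.trans ?_
    refine setIntegral_mono_on ?_ (jY.sub jX) measurableSet_Ioc ?_
    · refine Integrable.bdd_mul (c := w (-CY)) hD hW.measurable.aestronglyMeasurable ?_
      filter_upwards [ae_restrict_mem measurableSet_Ioc] with r hr
      rw [← hWeq hr, Real.norm_of_nonneg (wpos _)]
      exact qbd r hr
    · intro r hr
      rw [← hWeq hr]
      have := key (ℓ (qf P U r)) (ℓ (qf P V r))
      rw [hvℓ _ (nU r hr), hvℓ _ (nV r hr)] at this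
      exact this
  · intro α hα
    rcases hα.1.eq_or_lt with h0 | h0
    · simp [← h0]
    · have hsub : Ioc 0 α ⊆ Ioc (0:ℝ) 1 := Ioc_subset_Ioc_right hα.2
      rw [intervalIntegral.integral_sub]
      · have := h (1 - α) ⟨by linarith [hα.2], by linarith⟩
        unfold ES at this
        rw [if_pos (by linarith), if_pos (by linarith)] at this
        rw [sub_sub_cancel, neg_mul, neg_mul, neg_le_neg_iff] at this
        have := (mul_le_mul_iff_right₀ (one_div_pos.2 h0)).1 this
        linarith
      · rw [intervalIntegrable_iff_integrableOn_Ioc_of_le hα.1]; exact qV.mono_set hsub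
      · rw [intervalIntegrable_iff_integrableOn_Ioc_of_le hα.1]; exact qU.mono_set hsub

lemma MemX.expBounds {c : ℝ} (hc : c < 0) {X : Ω → ℝ} (hX : MemX P X) :
    Measurable (fun ω => -Real.exp (c * X ω)) ∧ ∃ C : ℝ,
      (∀ᵐ ω ∂P, -Real.exp (c * (-C)) ≤ -Real.exp (c * X ω)) ∧
      (∀ᵐ ω ∂P, -Real.exp (c * X ω) ≤ -Real.exp (c * C)) := by
  obtain ⟨mX, C, hC⟩ := hX
  refine ⟨by fun_prop, C, ?_, ?_⟩
  · filter_upwards [hC] with ω hω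
    have := (abs_le.1 hω).1
    rw [neg_le_neg_iff, Real.exp_le_exp]; nlinarith
  · filter_upwards [hC] with ω hω
    have := (abs_le.1 hω).2
    rw [neg_le_neg_iff, Real.exp_le_exp]; nlinarith

lemma ES_of_vSD {c : ℝ} (hc : c < 0) {X Y : Ω → ℝ} (hX : MemX P X) (hY : MemX P Y)
    (h : vSD P Set.univ (fun x => -Real.exp (c * x)) X Y) {p : ℝ} (hp : p ∈ Icc (0:ℝ) 1) :
    ES P p (fun ω => -Real.exp (c * Y ω)) ≤ ES P p (fun ω => -Real.exp (c * X ω)) := by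
  obtain ⟨mU, C, aU, bU⟩ := hX.expBounds P hc
  obtain ⟨mV, D, aV, bV⟩ := hY.expBounds P hc
  refine ES_le_of_stoploss P mU mV
    (a := min (-Real.exp (c * (-C))) (-Real.exp (c * (-D))))
    (b := max (-Real.exp (c * C)) (-Real.exp (c * D))) ?_ ?_ ?_ ?_ 
    (fun k => stoploss_of_vSD P hc hX hY h k) hp
  · exact aU.mono fun ω h => (min_le_left _ _).trans h
  · exact bU.mono fun ω h => h.trans (le_max_left _ _)
  · exact aV.mono fun ω h => (min_le_right _ _).trans h
  · exact bV.mono fun ω h => h.trans (le_max_right _ _)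

lemma ES_exp_pos {c : ℝ} (hc : c < 0) {X : Ω → ℝ} (hX : MemX P X) {p : ℝ} (hp : p ∈ Icc (0:ℝ) 1) :
    0 < ES P p (fun ω => -Real.exp (c * X ω)) := by
  obtain ⟨mU, C, aU, bU⟩ := hX.expBounds P hc
  have := (ES_bounds P mU aU bU hp).1
  rw [neg_neg] at this
  exact lt_of_lt_of_le (Real.exp_pos _) this

lemma ES_exp_shift (c : ℝ) (X : Ω → ℝ) (m p : ℝ) :
    ES P p (fun ω => -Real.exp (c * (X ω + m))) =
      Real.exp (c * m) * ES P p (fun ω => -Real.exp (c * X ω)) := by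
  rw [← ES_scale P _ (Real.exp_pos _)]
  congr 1
  funext ω
  rw [mul_add, Real.exp_add]; ring

lemma MemX.shift {X : Ω → ℝ} (hX : MemX P X) (m : ℝ) : MemX P (fun ω => X ω + m) := by
  obtain ⟨mX, C, hC⟩ := hX
  refine ⟨by fun_prop, C + |m|, ?_⟩
  filter_upwards [hC] with ω hω
  exact (abs_add_le _ _).trans (by linarith)

/-- The inner functional. -/
def Fg (c : ℝ) (g : ℝ → ℝ) (X : Ω → ℝ) : ℝ :=
  ⨆ p : Set.Icc (0:ℝ) 1, (1 / |c|) *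
    Real.log (ES P p.1 (fun ω => -Real.exp (c * X ω)) / g p.1)

lemma Fg_bdd {c : ℝ} (hc : c < 0) {g : ℝ → ℝ} (hg : MonotoneOn g (Icc 0 1))
    (hg0 : ∀ p ∈ Icc (0:ℝ) 1, 0 < g p) {X : Ω → ℝ} (hX : MemX P X) :
    BddAbove (range fun p : Set.Icc (0:ℝ) 1 => (1 / |c|) *
      Real.log (ES P p.1 (fun ω => -Real.exp (c * X ω)) / g p.1)) := by
  obtain ⟨mU, C, aU, bU⟩ := hX.expBounds P hc
  refine ⟨(1 / |c|) * Real.log (Real.exp (c * (-C)) / g 0), ?_⟩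
  rintro _ ⟨p, rfl⟩
  have h0 : (0:ℝ) ∈ Icc (0:ℝ) 1 := ⟨le_rfl, zero_le_one⟩
  have h1 := (ES_bounds P mU aU bU p.2).2
  rw [neg_neg] at h1
  have h2 := ES_exp_pos P hc hX p.2
  refine mul_le_mul_of_nonneg_left ?_ (by positivity)
  refine Real.log_le_log (div_pos h2 (hg0 _ p.2)) ?_
  exact div_le_div₀ (Real.exp_pos _).le h1 (hg0 _ h0) (hg h0 p.2 p.2.1)

lemma Fg_shift {c : ℝ} (hc : c < 0) {g : ℝ → ℝ} (hg : MonotoneOn g (Icc 0 1))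
    (hg0 : ∀ p ∈ Icc (0:ℝ) 1, 0 < g p) {X : Ω → ℝ} (hX : MemX P X) (m : ℝ) :
    Fg P c g (fun ω => X ω + m) ≤ Fg P c g X - m := by
  haveI : Nonempty (Icc (0:ℝ) 1) := ⟨⟨0, le_rfl, zero_le_one⟩⟩
  refine ciSup_le fun p => ?_
  have hE := ES_exp_pos P hc hX p.2
  have hgp := hg0 _ p.2
  have := le_ciSup (Fg_bdd P hc hg hg0 hX) p
  have e : (1 / |c|) * Real.log (ES P p.1 (fun ω => -Real.exp (c * (X ω + m))) / g p.1) =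
      (1 / |c|) * Real.log (ES P p.1 (fun ω => -Real.exp (c * X ω)) / g p.1) - m := by
    rw [ES_exp_shift, mul_div_assoc, Real.log_mul (Real.exp_pos _).ne' (div_pos hE hgp).ne',
      Real.log_exp, abs_of_neg hc]
    have hcn := hc.ne
    field_simp
    ring
  rw [e]
  exact sub_le_sub_right this m

lemma Fg_mono {c : ℝ} (hc : c < 0) {g : ℝ → ℝ} (hg : MonotoneOn g (Icc 0 1))
    (hg0 : ∀ p ∈ Icc (0:ℝ) 1, 0 < g p) {X Y : Ω → ℝ} (hX : MemX P X) (hY : MemX P Y)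
    (h : ∀ p ∈ Icc (0:ℝ) 1, ES P p (fun ω => -Real.exp (c * Y ω)) ≤
      ES P p (fun ω => -Real.exp (c * X ω))) :
    Fg P c g Y ≤ Fg P c g X := by
  refine ciSup_mono (Fg_bdd P hc hg hg0 hX) fun p => ?_
  have hE := ES_exp_pos P hc hY p.2
  have hgp := hg0 _ p.2
  refine mul_le_mul_of_nonneg_left ?_ (by positivity)
  exact Real.log_le_log (div_pos hE hgp) (div_le_div_of_nonneg_right (h _ p.2) hgp.le)

end cmp
/-- For `c < 0`, a monetary risk measure `ρ` is
`𝔢_c`-SD-consistent iff it admits the representation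
`ρ(X) = inf_{g ∈ 𝒢} sup_{p ∈ [0,1]} (1/|c|) log (ES_p(-e^{cX}) / g(p))`
for a family `𝒢` of nondecreasing functions `g : [0,1] → (0,∞)`. -/
theorem statement5 (P : Measure Ω) [IsProbabilityMeasure P] (hP : Atomless P)
    (c : ℝ) (hc : c < 0)
    (ρ : (Ω → ℝ) → ℝ) (hρ : IsRiskMeasure P ρ) :
    VSDConsistent P Set.univ (fun x => -Real.exp (c * x)) {X | MemX P X} ρ ↔
      ∃ 𝒢 : Set (ℝ → ℝ), 𝒢.Nonempty ∧
        (∀ g ∈ 𝒢, MonotoneOn g (Set.Icc 0 1) ∧ ∀ p ∈ Set.Icc (0:ℝ) 1, 0 < g p) ∧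
        (∀ X : Ω → ℝ, MemX P X →
          ρ X = ⨅ g : 𝒢, ⨆ p : Set.Icc (0:ℝ) 1,
            (1 / |c|) *
              Real.log (ES P p.1 (fun ω => -Real.exp (c * X ω)) / (g : ℝ → ℝ) p.1)) := by
  have h0 : MemX P (fun _ => (0:ℝ)) := ⟨measurable_const, 0, by simp⟩
  constructor
  · intro hcons
    set 𝒢 : Set (ℝ → ℝ) := {g | ∃ Z : Ω → ℝ, MemX P Z ∧ ρ Z ≤ 0 ∧
      g = fun p => ES P p (fun ω => -Real.exp (c * Z ω))} with h𝒢
    have hρ0 : ∀ X : Ω → ℝ, MemX P X → ρ (fun ω => X ω + ρ X) = 0 := by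
      intro X hX
      rw [hρ.2 X hX]; ring
    have hprop : ∀ g ∈ 𝒢, MonotoneOn g (Set.Icc 0 1) ∧ ∀ p ∈ Set.Icc (0:ℝ) 1, 0 < g p := by
      rintro g ⟨Z, hZ, -, rfl⟩
      obtain ⟨mU, C, aU, bU⟩ := hZ.expBounds P hc
      exact ⟨ES_mono P mU aU bU, fun p hp => ES_exp_pos P hc hZ hp⟩
    refine ⟨𝒢, ⟨_, _, h0.shift P _, (hρ0 _ h0).le, rfl⟩, hprop, ?_⟩
    intro X hX
    have hlow : ∀ g : 𝒢, ρ X ≤ Fg P c g X := by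
      rintro ⟨g, hg⟩
      have hgp := hprop g hg
      obtain ⟨Z, hZ, hZ0, rfl⟩ := hg
      set m := Fg P c (fun p => ES P p (fun ω => -Real.exp (c * Z ω))) X with hm
      have hv : vSD P Set.univ (fun x => -Real.exp (c * x)) Z (fun ω => X ω + m) := by
        refine vSD_of_ES P hc hZ (hX.shift P m) ?_
        intro p hp
        have hp' : p ∈ Icc (0:ℝ) 1 := ⟨hp.1, hp.2.le⟩
        have h1 := le_ciSup (Fg_bdd P hc hgp.1 hgp.2 hX) ⟨p, hp'⟩
        change _ ≤ m at h1
        simp only at h1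
        have hE := ES_exp_pos P hc hX hp'
        have hEZ := ES_exp_pos P hc hZ hp'
        rw [abs_of_neg hc, one_div, inv_mul_le_iff₀ (by linarith),
          Real.log_le_iff_le_exp (div_pos hE hEZ), div_le_iff₀ hEZ] at h1
        rw [ES_exp_shift]
        calc _ ≤ Real.exp (c * m) * (Real.exp (-c * m) * _) :=
              mul_le_mul_of_nonneg_left h1 (Real.exp_pos _).le
          _ = _ := by
              rw [← mul_assoc, ← Real.exp_add]
              simp
      have hL : ∀ W : Ω → ℝ, MemX P W →
          MemL1 P Set.univ (fun x => -Real.exp (c * x)) W := fun W hW =>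
        ⟨hW.1, by simp, integrable_comp_of_continuous P hW
          (u := fun x => -Real.exp (c * x)) (by fun_prop)⟩
      have h2 := hcons Z _ hZ (hX.shift P m) (hL _ hZ) (hL _ (hX.shift P m)) hv
      rw [hρ.2 X hX] at h2
      change ρ X ≤ m
      linarith
    have hmem : (fun p => ES P p (fun ω => -Real.exp (c * (X ω + ρ X)))) ∈ 𝒢 :=
      ⟨_, hX.shift P _, (hρ0 X hX).le, rfl⟩
    have : Nonempty 𝒢 := ⟨⟨_, hmem⟩⟩
    change ρ X = ⨅ g : 𝒢, Fg P c g X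
    apply le_antisymm (le_ciInf hlow)
    refine (ciInf_le ⟨ρ X, by rintro _ ⟨g, rfl⟩; exact hlow g⟩ ⟨_, hmem⟩).trans ?_
    have : Nonempty (Icc (0:ℝ) 1) := ⟨⟨0, le_rfl, zero_le_one⟩⟩
    refine ciSup_le fun p => ?_
    have hE := ES_exp_pos P hc hX p.2
    apply le_of_eq
    simp only [ES_exp_shift]
    rw [div_mul_cancel_right₀ hE.ne', Real.log_inv, Real.log_exp, abs_of_neg hc]
    have hcn := hc.ne
    field_simp
  · rintro ⟨𝒢, hne, hprop, hrep⟩ X Y hX hY - - hv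
    have hX : MemX P X := hX
    have hY : MemX P Y := hY
    have hrep' : ∀ X : Ω → ℝ, MemX P X → ρ X = ⨅ g : 𝒢, Fg P c g X := hrep
    have : Nonempty 𝒢 := hne.to_subtype
    have hbd : BddBelow (range fun g : 𝒢 => Fg P c g Y) := by
      by_contra hnb
      have hnb1 : ¬ BddBelow (range fun g : 𝒢 => Fg P c g (fun ω => Y ω + 1)) := by
        rintro ⟨b, hb⟩
        apply hnb
        refine ⟨b, ?_⟩
        rintro _ ⟨g, rfl⟩
        have h1 := hb ⟨g, rfl⟩
        have h2 := Fg_shift P hc (hprop g g.2).1 (hprop g g.2).2 hY 1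
        simp only at h1 ⊢
        linarith
      have e1 := hrep' Y hY
      have e2 := hrep' _ (hY.shift P 1)
      rw [Real.iInf_of_not_bddBelow hnb] at e1
      rw [Real.iInf_of_not_bddBelow hnb1, hρ.2 Y hY] at e2
      linarith
    rw [hrep' X hX, hrep' Y hY]
    refine ciInf_mono hbd fun g => ?_
    exact Fg_mono P hc (hprop g g.2).1 (hprop g g.2).2 hX hY
      (fun p hp => ES_of_vSD P hc hX hY hv hp)

end Paper
end
end

section
/- In the risk-minimisation setting with a single function g, set κ_g* := x₀ / ∫₀¹ g(u) dμ(u). Then: (a) ES_p(ĝ′₋(U)) = g(p) for all p ∈ [0,1]; (b) the problem of minimising κ_g(L) over L ∈ 𝓔 subject to E_Q[L] ≥ x₀ has optimal value κ_g*, and L* := −κ_g*·ĝ′₋(U) is a solution; (c) if dQ/dℙ has a continuous distribution, then L* is the ℙ-a.s. unique solution. -/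
open MeasureTheory Filter Set

noncomputable section

namespace Paper

variable {Ω : Type*} [MeasurableSpace Ω]

/-- Left derivative. -/
def lderiv (f : ℝ → ℝ) (p : ℝ) : ℝ := derivWithin f (Set.Iio p) p

/-- `κ_g(L) = sup_{p ∈ [0,1]} ES_p(-L) / g(p)`. -/
def kG (P : Measure Ω) (g : ℝ → ℝ) (L : Ω → ℝ) : ℝ :=
  ⨆ p : Set.Icc (0:ℝ) 1, ES P p.1 (fun ω => -L ω) / g p.1

/-- `∫₀¹ g dμ`, where `μ` has density `1 - t` with respect to `φ`. -/
def intMu (φ : Measure ℝ) (g : ℝ → ℝ) : ℝ :=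
  ∫ u, g u ∂(φ.withDensity fun t => ENNReal.ofReal (1 - t))

set_option linter.unusedSectionVars false

section helpers

variable {P : Measure Ω} [IsProbabilityMeasure P] {X : Ω → ℝ}

lemma F_eq_cdf (hX : AEMeasurable X P) (x : ℝ) :
    (P {ω | X ω ≤ x}).toReal = ProbabilityTheory.cdf (P.map X) x := by
  have := Measure.isProbabilityMeasure_map hX
  rw [ProbabilityTheory.cdf_eq_real, measureReal_def, Measure.map_apply_of_aemeasurable hX measurableSet_Iic]
  rfl

lemma qset_bdd (hX : AEMeasurable X P) {r : ℝ} (hr : 0 < r) :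
    BddBelow {x : ℝ | r ≤ (P {ω | X ω ≤ x}).toReal} := by
  have h := (ProbabilityTheory.tendsto_cdf_atBot (P.map X)).eventually (gt_mem_nhds hr)
  obtain ⟨b, hb⟩ := h.exists
  refine ⟨b, fun x hx => ?_⟩
  rw [mem_ofPred_eq, F_eq_cdf hX] at hx
  by_contra hlt
  have := ProbabilityTheory.monotone_cdf (P.map X) (le_of_lt (not_le.1 hlt))
  linarith

lemma qset_ne (hX : AEMeasurable X P) {r : ℝ} (hr : r < 1) :
    {x : ℝ | r ≤ (P {ω | X ω ≤ x}).toReal}.Nonempty := by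
  have h := (ProbabilityTheory.tendsto_cdf_atTop (P.map X)).eventually (lt_mem_nhds hr)
  obtain ⟨b, hb⟩ := h.exists
  refine ⟨b, ?_⟩
  rw [mem_ofPred_eq, F_eq_cdf hX]
  exact hb.le

lemma qf_le_iff_s17 (hX : AEMeasurable X P) {r : ℝ} (hr : r ∈ Ioo (0:ℝ) 1) (x : ℝ) :
    qf P X r ≤ x ↔ r ≤ (P {ω | X ω ≤ x}).toReal := by
  constructor
  · intro h
    rw [F_eq_cdf hX]
    have hc := (ProbabilityTheory.cdf (P.map X)).right_continuous x
    have hc' : Tendsto (ProbabilityTheory.cdf (P.map X)) (nhdsWithin x (Ioi x))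
        (nhds (ProbabilityTheory.cdf (P.map X) x)) := hc.mono_left (nhdsWithin_mono _ Ioi_subset_Ici_self)
    refine ge_of_tendsto hc' ?_
    filter_upwards [self_mem_nhdsWithin] with y hy
    have hlt : qf P X r < y := lt_of_le_of_lt h hy
    obtain ⟨z, hz, hzy⟩ := exists_lt_of_csInf_lt (qset_ne hX hr.2) hlt
    rw [mem_ofPred_eq, F_eq_cdf hX] at hz
    exact hz.trans (ProbabilityTheory.monotone_cdf (P.map X) hzy.le)
  · intro h
    exact csInf_le (qset_bdd hX hr.1) h

lemma qf_mono (hX : AEMeasurable X P) : MonotoneOn (qf P X) (Ioo 0 1) := by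
  intro r hr s hs hrs
  rw [qf_le_iff_s17 hX hr]
  exact hrs.trans ((qf_le_iff_s17 hX hs _).1 le_rfl)

lemma qf_aem (hX : AEMeasurable X P) : AEMeasurable (qf P X) (volume.restrict (Ioo (0:ℝ) 1)) :=
  aemeasurable_restrict_of_monotoneOn measurableSet_Ioo (qf_mono hX)

instance : IsProbabilityMeasure (volume.restrict (Ioo (0:ℝ) 1)) := ⟨by simp⟩

lemma map_qf_s17 (hX : AEMeasurable X P) :
    (volume.restrict (Ioo (0:ℝ) 1)).map (qf P X) = P.map X := by
  have := Measure.isProbabilityMeasure_map hX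
  have := Measure.isProbabilityMeasure_map (qf_aem hX)
  refine Measure.ext_of_Iic _ _ fun x => ?_
  rw [Measure.map_apply_of_aemeasurable (qf_aem hX) measurableSet_Iic,
    Measure.map_apply_of_aemeasurable hX measurableSet_Iic]
  have hp : (P (X ⁻¹' Iic x)) = ENNReal.ofReal (P {ω | X ω ≤ x}).toReal := by
    rw [ENNReal.ofReal_toReal (measure_ne_top _ _)]; rfl
  rw [hp, Measure.restrict_apply' measurableSet_Ioo]
  set F := (P {ω | X ω ≤ x}).toReal with hF
  have hF1 : F ≤ 1 := by
    have : P {ω | X ω ≤ x} ≤ 1 := prob_le_one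
    exact ENNReal.toReal_le_of_le_ofReal zero_le_one (by simpa using this)
  have hset : qf P X ⁻¹' Iic x ∩ Ioo 0 1 = Ioc 0 F ∩ Ioo 0 1 := by
    ext r
    simp only [mem_inter_iff, mem_preimage, mem_Iic]
    constructor
    · rintro ⟨h1, h2⟩
      exact ⟨⟨h2.1, (qf_le_iff_s17 hX h2 x).1 h1⟩, h2⟩
    · rintro ⟨h1, h2⟩
      exact ⟨(qf_le_iff_s17 hX h2 x).2 h1.2, h2⟩
  rw [hset]
  have h2 : (Ioc 0 F ∩ Ioo (0:ℝ) 1 : Set ℝ) =ᵐ[volume] (Ioc 0 F ∩ Ioc (0:ℝ) 1 : Set ℝ) :=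
    (ae_eq_refl _).inter Ioo_ae_eq_Ioc
  rw [measure_congr h2, Ioc_inter_Ioc]
  simp [hF1]

lemma integral_qf_s17 (hX : AEMeasurable X P) {f : ℝ → ℝ} (hf : Measurable f) :
    ∫ r in Ioo (0:ℝ) 1, f (qf P X r) = ∫ ω, f (X ω) ∂P := by
  rw [← integral_map (qf_aem hX) hf.aestronglyMeasurable, map_qf_s17 hX,
    integral_map hX hf.aestronglyMeasurable]

lemma qf_bound (hX : AEMeasurable X P) {C : ℝ} (hC : ∀ᵐ ω ∂P, |X ω| ≤ C) :
    ∀ r ∈ Ioo (0:ℝ) 1, |qf P X r| ≤ C := by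
  intro r hr
  rw [abs_le]
  constructor
  · by_contra h
    push Not at h
    have h1 := (qf_le_iff_s17 hX hr _).1 (le_refl (qf P X r))
    have h2 : P {ω | X ω ≤ qf P X r} = 0 := by
      have : ∀ᵐ ω ∂P, ¬ (X ω ≤ qf P X r) := by
        filter_upwards [hC] with ω hω
        have := (abs_le.1 hω).1
        linarith
      rw [ae_iff] at this
      simpa using this
    rw [h2] at h1
    simp at h1
    linarith [hr.1]
  · rw [qf_le_iff_s17 hX hr]
    have h2 : P {ω | X ω ≤ C} = 1 := by
      have : (univ : Set Ω) =ᵐ[P] {ω | X ω ≤ C} := by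
        refine Filter.EventuallyEq.symm (eventuallyEq_univ.2 ?_)
        filter_upwards [hC] with ω hω
        exact (abs_le.1 hω).2
      rw [← measure_congr this, measure_univ]
    rw [h2]; simpa using hr.2.le

lemma qf_integrableOn_s17 (hX : AEMeasurable X P) {C : ℝ} (hC : ∀ᵐ ω ∂P, |X ω| ≤ C) :
    IntegrableOn (qf P X) (Ioo (0:ℝ) 1) := by
  refine Integrable.of_bound (C := C) (qf_aem hX).aestronglyMeasurable ?_
  filter_upwards [ae_restrict_mem measurableSet_Ioo] with r hr
  exact qf_bound hX hC r hr

lemma bdd_integrable (hX : AEMeasurable X P) {C : ℝ} (hC : ∀ᵐ ω ∂P, |X ω| ≤ C) :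
    Integrable X P :=
  Integrable.of_bound (C := C) hX.aestronglyMeasurable hC

/-- master formula for the integrated quantile function -/
lemma int_qf_formula (hX : AEMeasurable X P) {C : ℝ} (hC : ∀ᵐ ω ∂P, |X ω| ≤ C)
    {a c : ℝ} (ha : a ∈ Ioo (0:ℝ) 1) (h1 : a ≤ (P {ω | X ω ≤ c}).toReal)
    (h2 : (P {ω | X ω < c}).toReal ≤ a) :
    ∫ r in (0:ℝ)..a, qf P X r = a * c - ∫ ω, max (c - X ω) 0 ∂P := by
  have hm : Measurable (fun x : ℝ => max (c - x) 0) := by fun_prop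
  rw [← integral_qf_s17 hX hm]
  have hint := qf_integrableOn_s17 hX hC
  have hle : ∀ r ∈ Ioc (0:ℝ) a, qf P X r ≤ c := fun r hr =>
    (qf_le_iff_s17 hX ⟨hr.1, hr.2.trans_lt ha.2⟩ c).2 (hr.2.trans h1)
  have hge : ∀ r ∈ Ioo (0:ℝ) 1, r ∉ Ioc 0 a → c ≤ qf P X r := by
    intro r hr hra
    have hra' : a < r := by
      by_contra h
      exact hra ⟨hr.1, not_lt.1 h⟩
    by_contra hlt
    push Not at hlt
    have h3 := (qf_le_iff_s17 hX hr _).1 (le_refl (qf P X r))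
    have h4 : (P {ω | X ω ≤ qf P X r}).toReal ≤ (P {ω | X ω < c}).toReal :=
      ENNReal.toReal_mono (measure_ne_top _ _) (measure_mono fun ω hω => lt_of_le_of_lt hω hlt)
    linarith
  have hsub : Ioc 0 a ⊆ Ioo (0:ℝ) 1 := fun r hr => ⟨hr.1, hr.2.trans_lt ha.2⟩
  have key : ∫ r in Ioo (0:ℝ) 1, max (c - qf P X r) 0 = ∫ r in Ioc (0:ℝ) a, (c - qf P X r) := by
    rw [setIntegral_eq_of_subset_of_forall_sdiff_eq_zero (s := Ioc 0 a) measurableSet_Ioo hsub]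
    · refine setIntegral_congr_fun measurableSet_Ioc fun r hr => ?_
      have := hle r hr
      exact max_eq_left (by linarith)
    · intro r hr
      have := hge r hr.1 hr.2
      exact max_eq_right (by linarith)
  rw [key, integral_sub (by simp) (hint.mono_set hsub), intervalIntegral.integral_of_le ha.1.le]
  simp [ha.1.le]

lemma int_qf_one (hX : AEMeasurable X P) :
    ∫ r in (0:ℝ)..1, qf P X r = ∫ ω, X ω ∂P := by
  rw [intervalIntegral.integral_of_le zero_le_one, integral_Ioc_eq_integral_Ioo]
  exact integral_qf_s17 hX measurable_id

lemma int_qf_le (hX : AEMeasurable X P) {C : ℝ} (hC : ∀ᵐ ω ∂P, |X ω| ≤ C)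
    {A : Set Ω} (hA : MeasurableSet A) {a : ℝ} (ha : a ∈ Ioc (0:ℝ) 1) (hPA : (P A).toReal = a) :
    ∫ r in (0:ℝ)..a, qf P X r ≤ ∫ ω in A, X ω ∂P := by
  have hXi := bdd_integrable hX hC
  rcases eq_or_lt_of_le ha.2 with h | h
  · subst h
    rw [int_qf_one hX]
    have : P A = 1 := by rw [← ENNReal.toReal_eq_one_iff, hPA]
    have h2 : ∀ᵐ ω ∂P, ω ∈ A := (prob_compl_eq_zero_iff hA).2 this
    rw [Measure.restrict_eq_self_of_ae_mem h2]
  · have ha' : a ∈ Ioo (0:ℝ) 1 := ⟨ha.1, h⟩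
    set c := qf P X a with hc
    have h1 := (qf_le_iff_s17 hX ha' _).1 (le_refl c)
    have h2 : (P {ω | X ω < c}).toReal ≤ a := by
      have hlt : P {ω | X ω < c} ≤ ENNReal.ofReal a := by
        have hU : {ω | X ω < c} = ⋃ n : ℕ, {ω | X ω ≤ c - 1 / ((n:ℝ) + 1)} := by
          ext ω
          simp only [mem_ofPred_eq, mem_iUnion]
          constructor
          · intro h
            obtain ⟨n, hn⟩ := exists_nat_one_div_lt (sub_pos.2 h)
            exact ⟨n, by linarith⟩
          · rintro ⟨n, hn⟩
            have : (0:ℝ) < 1 / ((n:ℝ) + 1) := by positivity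
            linarith
        rw [hU, Monotone.measure_iUnion]
        · refine iSup_le fun n => ?_
          have hlt : c - 1 / ((n:ℝ) + 1) < qf P X a := by
            have : (0:ℝ) < 1 / ((n:ℝ) + 1) := by positivity
            linarith
          have h3 := mt (qf_le_iff_s17 hX ha' _).2 (not_le.2 hlt)
          push Not at h3
          rw [← ENNReal.ofReal_toReal (measure_ne_top P {ω | X ω ≤ c - 1 / ((n:ℝ) + 1)})]
          exact ENNReal.ofReal_le_ofReal h3.le
        · intro n k hnk ω hω
          simp only [mem_ofPred_eq] at hω ⊢
          have : 1 / ((k:ℝ) + 1) ≤ 1 / ((n:ℝ) + 1) :=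
            one_div_le_one_div_of_le (by positivity) (by exact_mod_cast Nat.succ_le_succ hnk)
          linarith
      exact ENNReal.toReal_le_of_le_ofReal ha.1.le hlt
    rw [int_qf_formula hX hC ha' h1 h2]
    have hi : Integrable (fun ω => max (c - X ω) 0) P :=
      ((integrable_const c).sub hXi).sup (integrable_const 0)
    have e1 : ∫ ω in A, (c - X ω) ∂P ≤ ∫ ω, max (c - X ω) 0 ∂P := by
      calc ∫ ω in A, (c - X ω) ∂P ≤ ∫ ω in A, max (c - X ω) 0 ∂P :=
            integral_mono (((integrable_const c).sub hXi).integrableOn) hi.integrableOn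
              (fun ω => le_max_left _ _)
        _ ≤ _ := setIntegral_le_integral hi (Eventually.of_forall fun ω => le_max_right _ _)
    rw [integral_sub (integrable_const c).integrableOn hXi.integrableOn] at e1
    simp only [integral_const, smul_eq_mul, measureReal_def, Measure.restrict_apply_univ, hPA] at e1
    linarith

lemma int_qf_eq_s17 (hX : AEMeasurable X P) {C : ℝ} (hC : ∀ᵐ ω ∂P, |X ω| ≤ C)
    {A : Set Ω} (hA : MeasurableSet A) {a c : ℝ} (ha : a ∈ Ioo (0:ℝ) 1) (hPA : (P A).toReal = a)
    (h1 : ∀ᵐ ω ∂P, ω ∈ A → X ω ≤ c) (h2 : ∀ᵐ ω ∂P, ω ∉ A → c ≤ X ω) :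
    ∫ r in (0:ℝ)..a, qf P X r = ∫ ω in A, X ω ∂P := by
  have hXi := bdd_integrable hX hC
  have e1 : a ≤ (P {ω | X ω ≤ c}).toReal := by
    rw [← hPA]
    exact ENNReal.toReal_mono (measure_ne_top _ _) (measure_mono_ae h1)
  have e2 : (P {ω | X ω < c}).toReal ≤ a := by
    rw [← hPA]
    refine ENNReal.toReal_mono (measure_ne_top _ _) (measure_mono_ae ?_)
    filter_upwards [h2] with ω hω (hlt : X ω < c)
    by_contra h
    exact absurd (hω h) (not_le.2 hlt)
  rw [int_qf_formula hX hC ha e1 e2]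
  have key : ∫ ω, max (c - X ω) 0 ∂P = ∫ ω in A, (c - X ω) ∂P := by
    rw [← setIntegral_eq_integral_of_ae_compl_eq_zero (s := A)]
    · refine setIntegral_congr_ae hA ?_
      filter_upwards [h1] with ω hω hm
      exact max_eq_left (by linarith [hω hm])
    · filter_upwards [h2] with ω hω hm
      exact max_eq_right (by linarith [hω hm])
  rw [key, integral_sub (integrable_const c).integrableOn hXi.integrableOn]
  simp only [integral_const, smul_eq_mul, measureReal_def, Measure.restrict_apply_univ, hPA]
  ring

lemma lderiv_anti {f : ℝ → ℝ} (hf : ConcaveOn ℝ (Icc 0 1) f) :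
    AntitoneOn (lderiv f) (Ioo 0 1) := by
  have h := hf.neg.monotoneOn_leftDeriv
  rw [interior_Icc] at h
  intro x hx y hy hxy
  have := h hx hy hxy
  simp only [derivWithin.neg] at this
  unfold lderiv
  linarith

lemma aem_anti {k : ℝ → ℝ} (hk : AntitoneOn k (Ioo 0 1)) :
    AEMeasurable k (volume.restrict (Ioo (0:ℝ) 1)) :=
  aemeasurable_restrict_of_antitoneOn measurableSet_Ioo hk

lemma integrableOn_anti {k : ℝ → ℝ} (hk : AntitoneOn k (Ioo 0 1)) {C : ℝ}
    (hC : ∀ u ∈ Ioo (0:ℝ) 1, |k u| ≤ C) : IntegrableOn k (Ioo (0:ℝ) 1) := by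
  refine Integrable.of_bound (C := C) (aem_anti hk).aestronglyMeasurable ?_
  filter_upwards [ae_restrict_mem measurableSet_Ioo] with r hr
  exact hC r hr

lemma ftc_left {f : ℝ → ℝ} (hf : ConcaveOn ℝ (Icc 0 1) f) (hfc : ContinuousOn f (Icc 0 1))
    (hd : ∀ p ∈ Ioo (0:ℝ) 1, DifferentiableWithinAt ℝ f (Iio p) p) {C : ℝ}
    (hC : ∀ u ∈ Ioo (0:ℝ) 1, |lderiv f u| ≤ C) {t : ℝ} (ht : t ∈ Icc (0:ℝ) 1) :
    ∫ u in t..1, lderiv f u = f 1 - f t := by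
  have hi : IntervalIntegrable (lderiv f) volume t 1 := by
    rw [intervalIntegrable_iff_integrableOn_Ioo_of_le ht.2]
    exact (integrableOn_anti (lderiv_anti hf) hC).mono_set (Ioo_subset_Ioo_left ht.1)
  have h := intervalIntegral.integral_eq_sub_of_hasDeriv_right_of_le (a := -1) (b := -t)
    (f := fun s => f (-s)) (f' := fun s => - lderiv f (-s)) (by linarith [ht.2]) ?_ ?_ ?_
  · have e := intervalIntegral.integral_comp_neg (a := -1) (b := -t) (lderiv f)
    simp only [neg_neg] at e h
    rw [intervalIntegral.integral_neg, e] at h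
    linarith
  · refine hfc.comp (by fun_prop) ?_
    intro s hs
    constructor <;> linarith [hs.1, hs.2, ht.1]
  · intro s hs
    have hs' : -s ∈ Ioo (0:ℝ) 1 := by
      constructor <;> linarith [hs.1, hs.2, ht.1]
    have h1 : HasDerivWithinAt f (lderiv f (-s)) (Iio (-s)) (-s) := (hd _ hs').hasDerivWithinAt
    have h2 : HasDerivWithinAt (fun s : ℝ => -s) (-1) (Ioi s) s := (hasDerivAt_neg s).hasDerivWithinAt
    have h3 := HasDerivWithinAt.comp s h1 h2 (fun x (hx : s < x) => neg_lt_neg hx)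
    have h5 : HasDerivWithinAt (fun s => f (-s)) (lderiv f (-s) * (-1)) (Ioi s) s := h3
    simpa using h5
  · have := (hi.comp_mul_left (c := -1))
    have h4 : IntervalIntegrable (fun s => lderiv f (-s)) volume (-1) (-t) := by
      simpa [div_neg] using this.symm
    exact h4.neg


lemma U_mem {U : Ω → ℝ} (hUm : Measurable U)
    (hU : P.map U = volume.restrict (Ioo (0:ℝ) 1)) : ∀ᵐ ω ∂P, U ω ∈ Ioo (0:ℝ) 1 := by
  have : ∀ᵐ u ∂(P.map U), u ∈ Ioo (0:ℝ) 1 := by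
    rw [hU]; exact ae_restrict_mem measurableSet_Ioo
  exact ae_of_ae_map hUm.aemeasurable this

lemma U_ae {U : Ω → ℝ} (hUm : Measurable U)
    (hU : P.map U = volume.restrict (Ioo (0:ℝ) 1)) {p : ℝ → Prop} (h : ∀ᵐ u ∂(volume.restrict (Ioo (0:ℝ) 1)), p u) : ∀ᵐ ω ∂P, p (U ω) := by
  rw [← hU] at h
  exact ae_of_ae_map hUm.aemeasurable h

lemma P_U {U : Ω → ℝ} (hUm : Measurable U)
    (hU : P.map U = volume.restrict (Ioo (0:ℝ) 1)) {t : ℝ} (ht : t ∈ Icc (0:ℝ) 1) : (P {ω | t ≤ U ω}).toReal = 1 - t := by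
  have : P {ω | t ≤ U ω} = P.map U (Ici t) := by
    rw [Measure.map_apply hUm measurableSet_Ici]; rfl
  have h2 : (Ici t ∩ Ioo (0:ℝ) 1 : Set ℝ) =ᵐ[volume] (Ioi t ∩ Ioc (0:ℝ) 1 : Set ℝ) :=
    Ioi_ae_eq_Ici.symm.inter Ioo_ae_eq_Ioc
  have h3 : (Ioi t ∩ Ioc (0:ℝ) 1 : Set ℝ) = Ioc t 1 := by
    ext x; simp only [mem_inter_iff, mem_Ioi, mem_Ioc]
    exact ⟨fun h => ⟨h.1, h.2.2⟩, fun h => ⟨h.1, ht.1.trans_lt h.1, h.2⟩⟩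
  rw [this, hU, Measure.restrict_apply' measurableSet_Ioo, measure_congr h2, h3, Real.volume_Ioc,
    ENNReal.toReal_ofReal (by linarith [ht.2])]

lemma P_Ioo {U : Ω → ℝ} (hUm : Measurable U)
    (hU : P.map U = volume.restrict (Ioo (0:ℝ) 1)) {s t : ℝ} (hs : 0 ≤ s) (ht : t ≤ 1) : P {ω | U ω ∈ Ioo s t} = ENNReal.ofReal (t - s) := by
  have : P {ω | U ω ∈ Ioo s t} = P.map U (Ioo s t) := by
    rw [Measure.map_apply hUm measurableSet_Ioo]; rfl
  rw [this, hU, Measure.restrict_apply' measurableSet_Ioo,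
    inter_eq_self_of_subset_left (Ioo_subset_Ioo hs ht), Real.volume_Ioo]

lemma int_kU {U : Ω → ℝ} (hUm : Measurable U)
    (hU : P.map U = volume.restrict (Ioo (0:ℝ) 1)) {k : ℝ → ℝ} (hk : AEMeasurable k (volume.restrict (Ioo (0:ℝ) 1))) {t : ℝ}
    (ht : t ∈ Icc (0:ℝ) 1) : ∫ ω in {ω | t ≤ U ω}, k (U ω) ∂P = ∫ u in t..1, k u := by
  have h := setIntegral_map (μ := P) (f := k) (g := U) (s := Ici t) measurableSet_Ici
    (by rw [hU]; exact hk.aestronglyMeasurable) hUm.aemeasurable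
  have h2 : (Ici t ∩ Ioo (0:ℝ) 1 : Set ℝ) =ᵐ[volume] (Ioi t ∩ Ioc (0:ℝ) 1 : Set ℝ) :=
    Ioi_ae_eq_Ici.symm.inter Ioo_ae_eq_Ioc
  have h3 : (Ioi t ∩ Ioc (0:ℝ) 1 : Set ℝ) = Ioc t 1 := by
    ext x; simp only [mem_inter_iff, mem_Ioi, mem_Ioc]
    exact ⟨fun h => ⟨h.1, h.2.2⟩, fun h => ⟨h.1, ht.1.trans_lt h.1, h.2⟩⟩
  rw [hU, Measure.restrict_restrict measurableSet_Ici, setIntegral_congr_set h2, h3] at h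
  rw [intervalIntegral.integral_of_le ht.2, h]
  rfl

lemma kU_aem {U : Ω → ℝ} (hUm : Measurable U)
    (hU : P.map U = volume.restrict (Ioo (0:ℝ) 1)) {k : ℝ → ℝ} (hk : AntitoneOn k (Ioo 0 1)) : AEMeasurable (fun ω => k (U ω)) P := by
  have := aem_anti hk
  rw [← hU] at this
  exact this.comp_measurable hUm

lemma kU_bdd {U : Ω → ℝ} (hUm : Measurable U)
    (hU : P.map U = volume.restrict (Ioo (0:ℝ) 1)) {k : ℝ → ℝ} {C : ℝ} (hC : ∀ u ∈ Ioo (0:ℝ) 1, |k u| ≤ C) :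
    ∀ᵐ ω ∂P, |k (U ω)| ≤ C := by
  filter_upwards [U_mem hUm hU] with ω hω using hC _ hω

lemma qf_kU {U : Ω → ℝ} (hUm : Measurable U)
    (hU : P.map U = volume.restrict (Ioo (0:ℝ) 1)) {k : ℝ → ℝ} (hk : AntitoneOn k (Ioo 0 1)) {C : ℝ}
    (hC : ∀ u ∈ Ioo (0:ℝ) 1, |k u| ≤ C) {p : ℝ} (hp : p ∈ Ico (0:ℝ) 1) :
    ∫ r in (0:ℝ)..(1 - p), qf P (fun ω => k (U ω)) r = ∫ u in p..1, k u := by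
  rw [← int_kU hUm hU (aem_anti hk) ⟨hp.1, hp.2.le⟩]
  rcases eq_or_lt_of_le hp.1 with h | h
  · subst h
    rw [sub_zero, int_qf_one (kU_aem hUm hU hk)]
    have : ∀ᵐ ω ∂P, ω ∈ {ω | 0 ≤ U ω} := by
      filter_upwards [U_mem hUm hU] with ω hω using hω.1.le
    rw [Measure.restrict_eq_self_of_ae_mem this]
  · refine int_qf_eq_s17 (kU_aem hUm hU hk) (kU_bdd hUm hU hC) (measurableSet_le measurable_const hUm)
      (c := k p) ⟨by linarith [hp.2], by linarith⟩ (P_U hUm hU ⟨hp.1, hp.2.le⟩) ?_ ?_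
    · filter_upwards [U_mem hUm hU] with ω hω hm
      exact hk ⟨h, hp.2⟩ hω hm
    · filter_upwards [U_mem hUm hU] with ω hω hm
      exact hk hω ⟨h, hp.2⟩ (not_le.1 hm).le

lemma fubini {U : Ω → ℝ} (hUm : Measurable U)
    (hU : P.map U = volume.restrict (Ioo (0:ℝ) 1)) {φ0 : Measure ℝ} [SFinite φ0] {D L : Ω → ℝ}
    (hDpos : 0 ≤ D) (hDint : Integrable D P)
    (hDU : ∀ᵐ ω ∂P, φ0 (Iic (U ω)) = ENNReal.ofReal (D ω))
    (hL : AEMeasurable L P) {C : ℝ} (hC : ∀ᵐ ω ∂P, |L ω| ≤ C) :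
    Integrable (fun t => ∫ ω in {ω | t ≤ U ω}, L ω ∂P) φ0 ∧
    ∫ ω, L ω * D ω ∂P = ∫ t, (∫ ω in {ω | t ≤ U ω}, L ω ∂P) ∂φ0 := by
  have hms : MeasurableSet {z : Ω × ℝ | z.2 ≤ U z.1} :=
    measurableSet_le measurable_snd (hUm.comp measurable_fst)
  set F : Ω × ℝ → ℝ := {z : Ω × ℝ | z.2 ≤ U z.1}.indicator (fun z => L z.1) with hF
  have hF1 : ∀ ω, (fun t => F (ω, t)) = (Iic (U ω)).indicator (fun _ => L ω) := by
    intro ω; ext t; simp [hF, indicator]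
  have hF2 : ∀ t, (fun ω => F (ω, t)) = {ω | t ≤ U ω}.indicator L := by
    intro t; ext ω; simp [hF, indicator]
  have hreal : ∀ᵐ ω ∂P, φ0.real (Iic (U ω)) = D ω := by
    filter_upwards [hDU] with ω hω
    rw [measureReal_def, hω, ENNReal.toReal_ofReal (hDpos ω)]
  have hFm : AEStronglyMeasurable F (P.prod φ0) :=
    (hL.aestronglyMeasurable.comp_fst).indicator hms
  have hFi : Integrable F (P.prod φ0) := by
    rw [integrable_prod_iff hFm]
    constructor
    · filter_upwards [hDU] with ω hω
      rw [hF1, integrable_indicator_iff measurableSet_Iic]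
      exact integrableOn_const (by rw [hω]; exact ENNReal.ofReal_ne_top)
    · have h1 : Integrable (fun ω => |L ω| * D ω) P :=
        hDint.bdd_mul (c := C) (hL.abs.aestronglyMeasurable) (by simpa using hC)
      refine h1.congr ?_
      filter_upwards [hreal] with ω hω
      have : (fun t => ‖F (ω, t)‖) = (Iic (U ω)).indicator (fun _ => |L ω|) := by
        ext t
        rw [show F (ω, t) = _ from congrFun (hF1 ω) t, norm_indicator_eq_indicator_norm]
        rfl
      rw [this, integral_indicator measurableSet_Iic]
      simp [hω, mul_comm]
  have hmt : ∀ t, MeasurableSet {ω | t ≤ U ω} := fun t => measurableSet_le measurable_const hUm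
  have e2 : ∀ t, ∫ ω, F (ω, t) ∂P = ∫ ω in {ω | t ≤ U ω}, L ω ∂P := by
    intro t; rw [hF2, integral_indicator (hmt t)]
  refine ⟨?_, ?_⟩
  · have := hFi.integral_prod_right
    simpa only [e2] using this
  · have := integral_integral_swap (f := fun ω t => F (ω, t)) hFi
    simp only [e2] at this
    rw [← this]
    refine integral_congr_ae ?_
    filter_upwards [hreal] with ω hω
    rw [hF1, integral_indicator measurableSet_Iic]
    simp [hω, mul_comm]


lemma ES_lower {U : Ω → ℝ} (hUm : Measurable U) (hU : P.map U = volume.restrict (Ioo (0:ℝ) 1))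
    {L : Ω → ℝ} (hL : AEMeasurable L P) {C : ℝ} (hC : ∀ᵐ ω ∂P, |L ω| ≤ C)
    {t : ℝ} (ht : t ∈ Ico (0:ℝ) 1) :
    ∫ ω in {ω | t ≤ U ω}, L ω ∂P ≤ (1 - t) * ES P t (fun ω => -L ω) := by
  have h := int_qf_le (X := fun ω => -L ω) hL.neg (C := C) (by simpa using hC)
    (A := {ω | t ≤ U ω}) (measurableSet_le measurable_const hUm)
    (a := 1 - t) ⟨by linarith [ht.2], by linarith [ht.1]⟩ (P_U hUm hU ⟨ht.1, ht.2.le⟩)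
  rw [integral_neg] at h
  have h1 : (0:ℝ) < 1 - t := by linarith [ht.2]
  unfold ES
  rw [if_pos ht.2]
  have : (1 - t) * (-(1 / (1 - t)) * ∫ r in (0:ℝ)..(1 - t), qf P (fun ω => -L ω) r)
      = - ∫ r in (0:ℝ)..(1 - t), qf P (fun ω => -L ω) r := by
    field_simp
  rw [this]
  linarith

lemma ES_le_C {L : Ω → ℝ} (hL : AEMeasurable L P) {C : ℝ} (hC : ∀ᵐ ω ∂P, |L ω| ≤ C)
    {t : ℝ} (ht : t ∈ Icc (0:ℝ) 1) : ES P t (fun ω => -L ω) ≤ C := by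
  have hX : AEMeasurable (fun ω => -L ω) P := hL.neg
  have hC' : ∀ᵐ ω ∂P, |(fun ω => -L ω) ω| ≤ C := by simpa using hC
  unfold ES
  split_ifs with h
  · have h1 : (0:ℝ) < 1 - t := by linarith
    have h2 : ∫ r in (0:ℝ)..(1 - t), (-C) ≤ ∫ r in (0:ℝ)..(1 - t), qf P (fun ω => -L ω) r := by
      refine intervalIntegral.integral_mono_on_of_le_Ioo h1.le (by simp) ?_ ?_
      · rw [intervalIntegrable_iff_integrableOn_Ioo_of_le h1.le]
        exact (qf_integrableOn_s17 hX hC').mono_set (Ioo_subset_Ioo_right (by linarith [ht.1]))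
      · intro r hr
        exact (abs_le.1 (qf_bound hX hC' r ⟨hr.1, by linarith [hr.2, ht.1]⟩)).1
    rw [intervalIntegral.integral_const, smul_eq_mul, sub_zero] at h2
    rw [neg_mul, one_div, ← mul_neg, inv_mul_le_iff₀ h1]
    linarith
  · refine csInf_le ⟨-C, fun m hm => ?_⟩ ?_
    · obtain ⟨ω, h1, h2⟩ := (hC.and hm).exists
      simp only [neg_neg] at h2
      exact (abs_le.1 h1).1.trans h2
    · show ∀ᵐ ω ∂P, -(-L ω) ≤ C
      filter_upwards [hC] with ω hω
      simpa using (abs_le.1 hω).2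

lemma ES_le_kG {L : Ω → ℝ} (hL : AEMeasurable L P) {C : ℝ} (hC : ∀ᵐ ω ∂P, |L ω| ≤ C)
    {g : ℝ → ℝ} (hg1 : MonotoneOn g (Set.Icc 0 1)) (hg3 : ∀ p ∈ Set.Icc (0:ℝ) 1, 0 < g p)
    {t : ℝ} (ht : t ∈ Icc (0:ℝ) 1) : ES P t (fun ω => -L ω) ≤ kG P g L * g t := by
  have hC0 : 0 ≤ C := by
    obtain ⟨ω, h1⟩ := hC.exists
    exact (abs_nonneg _).trans h1
  have h0 : (0:ℝ) ∈ Icc (0:ℝ) 1 := by simp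
  rw [← div_le_iff₀ (hg3 t ht)]
  refine le_ciSup (f := fun p : Set.Icc (0:ℝ) 1 => ES P p.1 (fun ω => -L ω) / g p.1)
    ⟨C / g 0, ?_⟩ ⟨t, ht⟩
  rintro _ ⟨p, rfl⟩
  exact div_le_div₀ hC0 (ES_le_C hL hC p.2) (hg3 0 h0) (hg1 h0 p.2 p.2.1)

lemma sfin (φ : Measure ℝ) (hφfin : ∀ t : ℝ, t < 1 → φ (Set.Icc 0 t) ≠ ⊤) :
    SigmaFinite (φ.restrict (Ico (0:ℝ) 1)) := by
  refine ⟨⟨{ set := fun n => Icc 0 (1 - 1 / ((n:ℝ) + 1)) ∪ (Ico 0 1)ᶜ, set_mem := fun _ => trivial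
             finite := ?_, spanning := ?_ }⟩⟩
  · intro n
    have hpos : (0:ℝ) < 1 / ((n:ℝ) + 1) := by positivity
    refine lt_of_le_of_lt (measure_union_le _ _) ?_
    have h0 : (φ.restrict (Ico (0:ℝ) 1)) (Ico 0 1)ᶜ = 0 := by
      rw [Measure.restrict_apply' measurableSet_Ico]; simp
    rw [h0, add_zero]
    refine lt_of_le_of_lt (Measure.restrict_apply_le _ _) ?_
    exact (hφfin _ (by linarith)).lt_top
  · ext x
    simp only [mem_iUnion, mem_univ, iff_true]
    by_cases hx : x ∈ Ico (0:ℝ) 1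
    · obtain ⟨n, hn⟩ := exists_nat_one_div_lt (sub_pos.2 hx.2)
      exact ⟨n, Or.inl ⟨hx.1, by linarith⟩⟩
    · exact ⟨0, Or.inr hx⟩

lemma phi_Iic (φ : Measure ℝ) {u : ℝ} (hu : u < 1) :
    (φ.restrict (Ico (0:ℝ) 1)) (Iic u) = φ (Icc 0 u) := by
  rw [Measure.restrict_apply' measurableSet_Ico]
  congr 1
  ext x
  simp only [mem_inter_iff, mem_Iic, mem_Ico, mem_Icc]
  exact ⟨fun h => ⟨h.2.1, h.1⟩, fun h => ⟨h.2, h.1, h.2.trans_lt hu⟩⟩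

lemma phi_U {U : Ω → ℝ} (hUm : Measurable U) (hU : P.map U = volume.restrict (Ioo (0:ℝ) 1))
    {D : Ω → ℝ} (hDm : Measurable D) (hDU : ∀ᵐ ω ∂P, D ω = qf P D (U ω))
    (φ : Measure ℝ) (hφfin : ∀ t : ℝ, t < 1 → φ (Set.Icc 0 t) ≠ ⊤)
    (hφ : ∀ t ∈ Set.Ico (0:ℝ) 1, (φ (Set.Icc 0 t)).toReal = Function.rightLim (qf P D) t) :
    ∀ᵐ ω ∂P, (φ.restrict (Ico (0:ℝ) 1)) (Iic (U ω)) = ENNReal.ofReal (D ω) := by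
  have hc := (qf_mono (P := P) hDm.aemeasurable).countable_not_continuousWithinAt
  have h1 : ∀ᵐ u ∂(volume.restrict (Ioo (0:ℝ) 1)),
      u ∉ {x | x ∈ Ioo (0:ℝ) 1 ∧ ¬ContinuousWithinAt (qf P D) (Ioo 0 1) x} :=
    (hc.ae_notMem volume).filter_mono (ae_mono Measure.restrict_le_self)
  filter_upwards [U_mem hUm hU, U_ae hUm hU h1, hDU] with ω h2 h3 h4
  have h5 : ContinuousWithinAt (qf P D) (Ioo 0 1) (U ω) := by
    by_contra h
    exact h3 ⟨h2, h⟩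
  have h6 : ContinuousAt (qf P D) (U ω) := h5.continuousAt (Ioo_mem_nhds h2.1 h2.2)
  have h7 := h6.continuousWithinAt (s := Ici (U ω)) |>.rightLim_eq
  rw [phi_Iic φ h2.2, ← ENNReal.ofReal_toReal (hφfin _ h2.2), hφ _ ⟨h2.1.le, h2.2⟩, h7, ← h4]

lemma intMu_eq (φ : Measure ℝ) (hφsupp : φ (Set.Icc (0:ℝ) 1)ᶜ = 0) (g : ℝ → ℝ) :
    intMu φ g = ∫ t, (1 - t) * g t ∂(φ.restrict (Ico (0:ℝ) 1)) := by
  unfold intMu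
  rw [integral_withDensity_eq_integral_toReal_smul (by fun_prop) (by simp),
    ← setIntegral_eq_integral_of_ae_compl_eq_zero (s := Ico (0:ℝ) 1)]
  · refine setIntegral_congr_fun measurableSet_Ico fun t ht => ?_
    simp [ENNReal.toReal_ofReal (show (0:ℝ) ≤ 1 - t by linarith [ht.2])]
  · have : ∀ᵐ t ∂φ, t ∈ Icc (0:ℝ) 1 := hφsupp
    filter_upwards [this] with t ht hn
    have : t = 1 := by
      by_contra h
      exact hn ⟨ht.1, lt_of_le_of_ne ht.2 h⟩
    simp [this]

lemma ES_h {U : Ω → ℝ} (hUm : Measurable U) (hU : P.map U = volume.restrict (Ioo (0:ℝ) 1))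
    {g h : ℝ → ℝ} (hg1 : MonotoneOn g (Set.Icc 0 1)) (hg2 : ContinuousOn g (Set.Icc 0 1))
    (hanti : AntitoneOn h (Ioo 0 1)) {C : ℝ} (hC : ∀ u ∈ Ioo (0:ℝ) 1, |h u| ≤ C)
    (hint : ∀ t ∈ Icc (0:ℝ) 1, ∫ u in t..1, h u = -((1 - t) * g t))
    {c : ℝ} (hc : 0 < c) {p : ℝ} (hp : p ∈ Icc (0:ℝ) 1) :
    ES P p (fun ω => c * h (U ω)) = c * g p := by
  have hle : ∀ u ∈ Ioo (0:ℝ) 1, -h u ≤ g 1 := by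
    intro u hu
    have h1 : ∫ x in u..1, h x ≤ ∫ x in u..1, h u := by
      refine intervalIntegral.integral_mono_on_of_le_Ioo hu.2.le ?_ (by simp) ?_
      · rw [intervalIntegrable_iff_integrableOn_Ioo_of_le hu.2.le]
        exact (integrableOn_anti hanti hC).mono_set (Ioo_subset_Ioo_left hu.1.le)
      · intro x hx
        exact hanti hu ⟨hu.1.trans hx.1, hx.2⟩ hx.1.le
    rw [hint u ⟨hu.1.le, hu.2.le⟩, intervalIntegral.integral_const, smul_eq_mul] at h1
    have h2 : (0:ℝ) < 1 - u := by linarith [hu.2]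
    have h3 : (1 - u) * (-h u) ≤ (1 - u) * g u := by linarith
    exact (le_of_mul_le_mul_left h3 h2).trans (hg1 ⟨hu.1.le, hu.2.le⟩ (by simp) hu.2.le)
  unfold ES
  split_ifs with hp1
  · have hk : AntitoneOn (fun u => c * h u) (Ioo 0 1) := fun x hx y hy hxy =>
      mul_le_mul_of_nonneg_left (hanti hx hy hxy) hc.le
    rw [qf_kU hUm hU (k := fun u => c * h u) hk (C := c * C) ?_ ⟨hp.1, hp1⟩]
    · rw [intervalIntegral.integral_const_mul, hint p hp]
      have : 1 - p ≠ 0 := by linarith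
      field_simp
    · intro u hu
      rw [abs_mul, abs_of_pos hc]
      exact mul_le_mul_of_nonneg_left (hC u hu) hc.le
  · have hp' : p = 1 := le_antisymm hp.2 (not_lt.1 hp1)
    subst hp'
    have hmem : c * g 1 ∈ {m : ℝ | ∀ᵐ ω ∂P, -(c * h (U ω)) ≤ m} := by
      show ∀ᵐ ω ∂P, -(c * h (U ω)) ≤ c * g 1
      filter_upwards [U_mem hUm hU] with ω hω
      have := mul_le_mul_of_nonneg_left (hle _ hω) hc.le
      linarith
    have hlb : ∀ m ∈ {m : ℝ | ∀ᵐ ω ∂P, -(c * h (U ω)) ≤ m}, c * g 1 ≤ m := by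
      intro m (hm : ∀ᵐ ω ∂P, -(c * h (U ω)) ≤ m)
      have hq : ∀ q ∈ Ico (0:ℝ) 1, c * g q ≤ m := by
        intro q hq
        have e1 := int_kU hUm hU (aem_anti hanti) ⟨hq.1, hq.2.le⟩
        rw [hint q ⟨hq.1, hq.2.le⟩] at e1
        have e2 : ∫ ω in {ω | q ≤ U ω}, -(c * h (U ω)) ∂P ≤ ∫ ω in {ω | q ≤ U ω}, m ∂P := by
          refine integral_mono_ae ?_ (by simp) (ae_restrict_of_ae hm)
          exact (((bdd_integrable (kU_aem hUm hU hanti) (kU_bdd hUm hU hC)).const_mul c).neg).integrableOn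
        rw [integral_neg, integral_const_mul, e1] at e2
        simp only [integral_const, smul_eq_mul, measureReal_def, Measure.restrict_apply_univ,
          P_U hUm hU ⟨hq.1, hq.2.le⟩] at e2
        have h2 : (0:ℝ) < 1 - q := by linarith [hq.2]
        refine le_of_mul_le_mul_left (a := 1 - q) ?_ h2
        linarith
      have ht : Tendsto g (nhdsWithin 1 (Ico 0 1)) (nhds (g 1)) :=
        (hg2 1 (by simp)).mono_left (nhdsWithin_mono _ Ico_subset_Icc_self)
      have : (nhdsWithin (1:ℝ) (Ico 0 1)).NeBot := by
        rw [← mem_closure_iff_nhdsWithin_neBot, closure_Ico (by norm_num)]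
        simp
      refine le_of_tendsto (ht.const_mul c) ?_
      filter_upwards [self_mem_nhdsWithin] with q hq' using hq q hq'
    exact le_antisymm (csInf_le ⟨_, hlb⟩ hmem) (le_csInf ⟨_, hmem⟩ hlb)

lemma qf_ae_eq {X Y : Ω → ℝ} (hX : AEMeasurable X P) (hY : AEMeasurable Y P)
    {C C' : ℝ} (hC : ∀ᵐ ω ∂P, |X ω| ≤ C) (hC' : ∀ᵐ ω ∂P, |Y ω| ≤ C')
    (h : ∀ a ∈ Ioo (0:ℝ) 1, ∫ r in (0:ℝ)..a, qf P X r = ∫ r in (0:ℝ)..a, qf P Y r) :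
    ∫ ω, X ω ^ 2 ∂P = ∫ ω, Y ω ^ 2 ∂P := by
  have hm : Measurable (fun x : ℝ => x ^ 2) := by fun_prop
  rw [← integral_qf_s17 hX hm, ← integral_qf_s17 hY hm]
  have i1 : IntervalIntegrable (qf P X) volume 0 1 := by
    rw [intervalIntegrable_iff_integrableOn_Ioo_of_le zero_le_one]
    exact qf_integrableOn_s17 hX hC
  have i2 : IntervalIntegrable (qf P Y) volume 0 1 := by
    rw [intervalIntegrable_iff_integrableOn_Ioo_of_le zero_le_one]
    exact qf_integrableOn_s17 hY hC'
  refine setIntegral_congr_ae measurableSet_Ioo ?_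
  filter_upwards [i1.ae_hasDerivAt_integral, i2.ae_hasDerivAt_integral] with r h1 h2 hr
  have hr' : r ∈ uIcc (0:ℝ) 1 := by
    rw [uIcc_of_le zero_le_one]; exact Ioo_subset_Icc_self hr
  have d1 := h1 hr' 0 (by simp)
  have d2 := h2 hr' 0 (by simp)
  have d3 := d2.congr_of_eventuallyEq (f₁ := fun x => ∫ r in (0:ℝ)..x, qf P X r) (by
    filter_upwards [Ioo_mem_nhds hr.1 hr.2] with a ha using h a ha)
  rw [d1.unique d3]

lemma memE_props {L : Ω → ℝ} (hL : MemE P L) :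
    AEMeasurable L P ∧ (∀ᵐ ω ∂P, 0 ≤ L ω) ∧ ∃ C : ℝ, ∀ᵐ ω ∂P, |L ω| ≤ C := by
  obtain ⟨Y, ⟨hYm, C, hC⟩, hY⟩ := hL
  refine ⟨⟨fun ω => Real.exp (Y ω), by fun_prop, hY⟩, ?_, Real.exp C, ?_⟩
  · filter_upwards [hY] with ω hω
    rw [hω]; positivity
  · filter_upwards [hY, hC] with ω hω h2
    rw [hω, abs_of_pos (Real.exp_pos _)]
    exact Real.exp_le_exp.2 ((le_abs_self _).trans h2)

lemma nu_Ici {U : Ω → ℝ} (hUm : Measurable U) {L : Ω → ℝ} (hLi : Integrable L P)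
    (hL0 : ∀ᵐ ω ∂P, 0 ≤ L ω) (t : ℝ) :
    ((P.withDensity fun ω => ENNReal.ofReal (L ω)).map U) (Ici t)
      = ENNReal.ofReal (∫ ω in {ω | t ≤ U ω}, L ω ∂P) := by
  rw [Measure.map_apply hUm measurableSet_Ici, withDensity_apply _ (hUm measurableSet_Ici),
    ofReal_integral_eq_lintegral_ofReal hLi.integrableOn (ae_restrict_of_ae hL0)]
  rfl

lemma nu_int {U : Ω → ℝ} (hUm : Measurable U) {L : Ω → ℝ} (hLi : Integrable L P)
    (hL0 : ∀ᵐ ω ∂P, 0 ≤ L ω) {k : ℝ → ℝ} (hk : Measurable k) :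
    ∫ u, k u ∂((P.withDensity fun ω => ENNReal.ofReal (L ω)).map U) = ∫ ω, L ω * k (U ω) ∂P := by
  rw [integral_map hUm.aemeasurable hk.aestronglyMeasurable,
    integral_withDensity_eq_integral_toReal_smul₀ (hLi.aemeasurable.ennreal_ofReal) (by simp)]
  refine integral_congr_ae ?_
  filter_upwards [hL0] with ω hω
  simp [ENNReal.toReal_ofReal hω]

lemma final_eq {U : Ω → ℝ} (hUm : Measurable U) (hU : P.map U = volume.restrict (Ioo (0:ℝ) 1))
    {L L' : Ω → ℝ} (hL : AEMeasurable L P) (hL' : AEMeasurable L' P) {C C' : ℝ}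
    (hC : ∀ᵐ ω ∂P, |L ω| ≤ C) (hC' : ∀ᵐ ω ∂P, |L' ω| ≤ C')
    (hL0 : ∀ᵐ ω ∂P, 0 ≤ L ω) (hL0' : ∀ᵐ ω ∂P, 0 ≤ L' ω)
    {k : ℝ → ℝ} (hk : Measurable k) (hLk : ∀ᵐ ω ∂P, L' ω = k (U ω))
    (h : ∀ t ∈ Ico (0:ℝ) 1, ∫ ω in {ω | t ≤ U ω}, L ω ∂P = ∫ ω in {ω | t ≤ U ω}, L' ω ∂P)
    (h2 : ∫ ω, L ω ^ 2 ∂P = ∫ ω, L' ω ^ 2 ∂P) : ∀ᵐ ω ∂P, L ω = L' ω := by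
  have hLi := bdd_integrable hL hC
  have hLi' := bdd_integrable hL' hC'
  have hall : ∀ t, ∫ ω in {ω | t ≤ U ω}, L ω ∂P = ∫ ω in {ω | t ≤ U ω}, L' ω ∂P := by
    intro t
    by_cases ht0 : t < 0
    · have e : ({ω | t ≤ U ω} : Set Ω) =ᵐ[P] {ω | 0 ≤ U ω} := by
        filter_upwards [U_mem hUm hU] with ω hω
        have a1 : t ≤ U ω := by linarith [hω.1]
        have a2 : 0 ≤ U ω := by linarith [hω.1]
        exact propext ⟨fun _ => a2, fun _ => a1⟩
      rw [setIntegral_congr_set e, setIntegral_congr_set e]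
      exact h 0 (by simp)
    · by_cases ht1 : t < 1
      · exact h t ⟨not_lt.1 ht0, ht1⟩
      · have e : ({ω | t ≤ U ω} : Set Ω) =ᵐ[P] (∅ : Set Ω) := by
          filter_upwards [U_mem hUm hU] with ω hω
          have a1 : ¬ t ≤ U ω := by linarith [hω.2]
          exact propext ⟨fun a => a1 a, fun a => absurd a (notMem_empty ω)⟩
        rw [setIntegral_congr_set e, setIntegral_congr_set e]
        simp
  have hfin : IsFiniteMeasure (P.withDensity fun ω => ENNReal.ofReal (L ω)) :=
    isFiniteMeasure_withDensity_ofReal hLi.2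
  have hν : (P.withDensity fun ω => ENNReal.ofReal (L ω)).map U
      = (P.withDensity fun ω => ENNReal.ofReal (L' ω)).map U := by
    refine Measure.ext_of_Ici _ _ fun t => ?_
    rw [nu_Ici hUm hLi hL0, nu_Ici hUm hLi' hL0', hall]
  have e1 := nu_int hUm hLi hL0 hk
  rw [hν, nu_int hUm hLi' hL0' hk] at e1
  have e2 : ∫ ω, L ω * L' ω ∂P = ∫ ω, L' ω ^ 2 ∂P := by
    calc ∫ ω, L ω * L' ω ∂P = ∫ ω, L ω * k (U ω) ∂P := by
          refine integral_congr_ae ?_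
          filter_upwards [hLk] with ω hω
          rw [hω]
      _ = ∫ ω, L' ω * k (U ω) ∂P := e1.symm
      _ = _ := by
          refine integral_congr_ae ?_
          filter_upwards [hLk] with ω hω
          simp only [hω]; ring
  have i1 : Integrable (fun ω => L ω ^ 2) P := by
    simp only [pow_two]
    exact hLi.bdd_mul (c := C) hL.aestronglyMeasurable hC
  have i2 : Integrable (fun ω => L' ω ^ 2) P := by
    simp only [pow_two]
    exact hLi'.bdd_mul (c := C') hL'.aestronglyMeasurable hC'
  have i3 : Integrable (fun ω => L ω * L' ω) P :=
    hLi'.bdd_mul (c := C) hL.aestronglyMeasurable hC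
  have e3 : ∫ ω, (L ω - L' ω) ^ 2 ∂P = 0 := by
    have : (fun ω => (L ω - L' ω) ^ 2) = fun ω => L ω ^ 2 - 2 * (L ω * L' ω) + L' ω ^ 2 := by
      ext ω; ring
    have i5 : Integrable (fun ω => L ω ^ 2 - 2 * (L ω * L' ω)) P := i1.sub (i3.const_mul 2)
    rw [this, integral_add i5 i2, integral_sub i1 (i3.const_mul 2),
      integral_const_mul, e2, h2]
    ring
  have i4 : Integrable (fun ω => (L ω - L' ω) ^ 2) P := by
    have : (fun ω => (L ω - L' ω) ^ 2) = fun ω => L ω ^ 2 - 2 * (L ω * L' ω) + L' ω ^ 2 := by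
      ext ω; ring
    rw [this]
    exact (i1.sub (i3.const_mul 2)).add i2
  rw [integral_eq_zero_iff_of_nonneg (fun ω => sq_nonneg _) i4] at e3
  filter_upwards [e3] with ω hω
  have : (L ω - L' ω) ^ 2 = 0 := hω
  have := pow_eq_zero_iff (two_ne_zero) |>.1 this
  linarith

end helpers

/-- Proposition on risk minimisation, single `g`. With
`κ_g* = x₀ / ∫₀¹ g dμ`: (a) `ES_p(ĝ′₋(U)) = g(p)` for all `p ∈ [0,1]`;
(b) the problem of minimising `κ_g(L)` over `L ∈ 𝓔` subject to `E_Q[L] ≥ x₀`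
has optimal value `κ_g*` and solution `L* = -κ_g* ĝ′₋(U)`; (c) if `dQ/dP` is
continuously distributed, `L*` is the a.s. unique solution. -/
theorem statement17 (P : Measure Ω) [IsProbabilityMeasure P] (hP : Atomless P)
    -- the density `D = dQ/dP` of the pricing measure `Q ≪ P`
    (D : Ω → ℝ) (hDmeas : Measurable D) (hDpos : 0 ≤ D)
    (hDint : Integrable D P) (hD1 : ∫ ω, D ω ∂P = 1)
    -- a uniform random variable `U` with `dQ/dP = q_{dQ/dP}(U)` a.s.
    (U : Ω → ℝ) (hUmeas : Measurable U)
    (hUdist : P.map U = volume.restrict (Set.Ioo (0:ℝ) 1))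
    (hDU : ∀ᵐ ω ∂P, D ω = qf P D (U ω))
    -- the function `g` and its hypotheses
    (g : ℝ → ℝ) (hg1 : MonotoneOn g (Set.Icc 0 1))
    (hg2 : ContinuousOn g (Set.Icc 0 1))
    (hg3 : ∀ p ∈ Set.Icc (0:ℝ) 1, 0 < g p)
    (hg4 : ConcaveOn ℝ (Set.Icc 0 1) (fun q => (1 - q) * g q))
    (hg5 : ∀ p ∈ Set.Ioo (0:ℝ) 1,
      DifferentiableWithinAt ℝ (fun q => (1 - q) * g q) (Set.Iio p) p)
    (m M : ℝ) (hM : 0 < M)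
    (hg6 : ∀ p ∈ Set.Ioo (0:ℝ) 1,
      m ≤ lderiv (fun q => (1 - q) * g q) p ∧
        lderiv (fun q => (1 - q) * g q) p ≤ -M)
    -- the Stieltjes measure `φ` of the right-continuous version of `q_{dQ/dP}`
    (φ : Measure ℝ) (hφfin : ∀ t : ℝ, t < 1 → φ (Set.Icc 0 t) ≠ ⊤)
    (hφsupp : φ (Set.Icc (0:ℝ) 1)ᶜ = 0)
    (hφ : ∀ t ∈ Set.Ico (0:ℝ) 1,
      (φ (Set.Icc 0 t)).toReal = Function.rightLim (qf P D) t)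
    -- the initial capital
    (x₀ : ℝ) (hx₀ : 0 < x₀) :
    (∀ p ∈ Set.Icc (0:ℝ) 1,
      ES P p (fun ω => lderiv (fun q => (1 - q) * g q) (U ω)) = g p) ∧
    (MemE P (fun ω => -(x₀ / intMu φ g) * lderiv (fun q => (1 - q) * g q) (U ω)) ∧
      x₀ ≤ ∫ ω, (-(x₀ / intMu φ g) * lderiv (fun q => (1 - q) * g q) (U ω)) * D ω ∂P ∧
      kG P g (fun ω => -(x₀ / intMu φ g) * lderiv (fun q => (1 - q) * g q) (U ω)) =
        x₀ / intMu φ g ∧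
      (∀ L : Ω → ℝ, MemE P L → x₀ ≤ ∫ ω, L ω * D ω ∂P →
        x₀ / intMu φ g ≤ kG P g L)) ∧
    ((∀ x : ℝ, P {ω | D ω = x} = 0) →
      ∀ L : Ω → ℝ, MemE P L → x₀ ≤ ∫ ω, L ω * D ω ∂P →
        kG P g L = x₀ / intMu φ g →
        ∀ᵐ ω ∂P, L ω =
          -(x₀ / intMu φ g) * lderiv (fun q => (1 - q) * g q) (U ω)) := by
  set f : ℝ → ℝ := fun q => (1 - q) * g q with hf
  set h : ℝ → ℝ := lderiv f with hh
  have hanti : AntitoneOn h (Ioo 0 1) := lderiv_anti hg4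
  have hfc : ContinuousOn f (Icc 0 1) := by
    apply ContinuousOn.mul _ hg2
    fun_prop
  have hC : ∀ u ∈ Ioo (0:ℝ) 1, |h u| ≤ -m := by
    intro u hu
    obtain ⟨h1, h2⟩ := hg6 u hu
    rw [abs_of_nonpos (by linarith)]
    linarith
  have hint : ∀ t ∈ Icc (0:ℝ) 1, ∫ u in t..1, h u = -((1 - t) * g t) := by
    intro t ht
    rw [ftc_left hg4 hfc hg5 hC ht]
    simp [hf]
  have hES : ∀ c : ℝ, 0 < c → ∀ p ∈ Icc (0:ℝ) 1, ES P p (fun ω => c * h (U ω)) = c * g p :=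
    fun c hc p hp => ES_h hUmeas hUdist hg1 hg2 hanti hC hint hc hp
  have hsf := sfin φ hφfin
  have hDU' := phi_U hUmeas hUdist hDmeas hDU φ hφfin hφ
  have hIM := intMu_eq φ hφsupp g
  set φ0 := φ.restrict (Ico (0:ℝ) 1) with hφ0
  have hmem0 : ∀ᵐ t ∂φ0, t ∈ Ico (0:ℝ) 1 := ae_restrict_mem measurableSet_Ico
  set I := intMu φ g with hI
  have hhm : AEMeasurable (fun ω => h (U ω)) P := kU_aem hUmeas hUdist hanti
  have hhb : ∀ᵐ ω ∂P, |h (U ω)| ≤ -m := kU_bdd hUmeas hUdist hC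
  -- integral of `h(U)` on `{t ≤ U}`
  have hset : ∀ t ∈ Icc (0:ℝ) 1, ∫ ω in {ω | t ≤ U ω}, h (U ω) ∂P = -((1 - t) * g t) := by
    intro t ht
    rw [int_kU hUmeas hUdist (aem_anti hanti) ht, hint t ht]
  obtain ⟨fi, fe⟩ := fubini hUmeas hUdist hDpos hDint hDU' hhm hhb
  have hae : (fun t => ∫ ω in {ω | t ≤ U ω}, h (U ω) ∂P) =ᵐ[φ0] fun t => -((1 - t) * g t) := by
    filter_upwards [hmem0] with t ht using hset t ⟨ht.1, ht.2.le⟩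
  have hgi : Integrable (fun t => (1 - t) * g t) φ0 := by
    have := (fi.congr hae).neg
    simpa using this
  have hIeq : ∫ ω, h (U ω) * D ω ∂P = -I := by
    rw [fe, integral_congr_ae hae, integral_neg, hIM]
  have hIpos : 0 < I := by
    have i1 : Integrable (fun ω => h (U ω) * D ω) P :=
      hDint.bdd_mul (c := -m) hhm.aestronglyMeasurable hhb
    have : ∫ ω, h (U ω) * D ω ∂P ≤ ∫ ω, (-M) * D ω ∂P := by
      refine integral_mono_ae i1 (hDint.const_mul _) ?_
      filter_upwards [U_mem hUmeas hUdist] with ω hω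
      exact mul_le_mul_of_nonneg_right (hg6 _ hω).2 (hDpos ω)
    rw [integral_const_mul, hD1, hIeq] at this
    linarith
  set κ := x₀ / I with hκ
  have hκpos : 0 < κ := div_pos hx₀ hIpos
  have hκI : κ * I = x₀ := by rw [hκ]; field_simp
  -- properties of a feasible position
  have hfeas : ∀ L : Ω → ℝ, MemE P L → x₀ ≤ ∫ ω, L ω * D ω ∂P →
      (∀ t ∈ Ico (0:ℝ) 1, ∫ ω in {ω | t ≤ U ω}, L ω ∂P ≤ kG P g L * ((1 - t) * g t)) ∧
      Integrable (fun t => ∫ ω in {ω | t ≤ U ω}, L ω ∂P) φ0 ∧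
      x₀ ≤ ∫ t, (∫ ω in {ω | t ≤ U ω}, L ω ∂P) ∂φ0 := by
    intro L hL hLx
    obtain ⟨hLm, hL0, C, hLC⟩ := memE_props hL
    obtain ⟨a1, a2⟩ := fubini hUmeas hUdist hDpos hDint hDU' hLm hLC
    refine ⟨fun t ht => ?_, a1, a2 ▸ hLx⟩
    have b1 := ES_lower hUmeas hUdist hLm hLC ht
    have b2 := ES_le_kG hLm hLC hg1 hg3 (t := t) ⟨ht.1, ht.2.le⟩
    have b3 := mul_le_mul_of_nonneg_left b2 (show (0:ℝ) ≤ 1 - t by linarith [ht.2])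
    linarith
  have hneg : (fun ω => - (-κ * h (U ω))) = fun ω => κ * h (U ω) := by
    ext ω; ring
  refine ⟨?_, ⟨?_, ?_, ?_, ?_⟩, ?_⟩
  · intro p hp
    have := hES 1 one_pos p hp
    simpa using this
  · -- membership in `𝓔`
    obtain ⟨k, hkm, hke⟩ := hhm
    refine ⟨fun ω => max (Real.log (κ * M)) (min (Real.log (κ * (-m))) (Real.log (-κ * k ω))),
      ⟨by fun_prop, max |Real.log (κ * M)| |Real.log (κ * (-m))|, ?_⟩, ?_⟩
    · refine Eventually.of_forall fun ω => ?_
      rw [abs_le]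
      constructor
      · have a1 := neg_abs_le (Real.log (κ * M))
        have a2 := le_max_left |Real.log (κ * M)| |Real.log (κ * (-m))|
        exact le_trans (by linarith) (le_max_left _ _)
      · refine max_le ?_ ((min_le_left _ _).trans ?_)
        · exact (le_abs_self _).trans (le_max_left _ _)
        · exact (le_abs_self _).trans (le_max_right _ _)
    · filter_upwards [hke, U_mem hUmeas hUdist] with ω h1 h2
      obtain ⟨h3, h4⟩ := hg6 _ h2
      have h1' : k ω = h (U ω) := h1.symm
      have p1 : κ * M ≤ -κ * h (U ω) := by nlinarith
      have p2 : -κ * h (U ω) ≤ κ * (-m) := by nlinarith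
      have p0 : 0 < κ * M := mul_pos hκpos hM
      rw [h1', min_eq_right (Real.log_le_log (p0.trans_le p1) p2),
        max_eq_right (Real.log_le_log p0 p1), Real.exp_log (p0.trans_le p1)]
  · have : ∫ ω, (-κ * h (U ω)) * D ω ∂P = x₀ := by
      simp only [mul_assoc]
      rw [integral_const_mul, hIeq, ← hκI]
      ring
    exact this.ge
  · unfold kG
    rw [hneg]
    have : ∀ p : Icc (0:ℝ) 1, ES P p.1 (fun ω => κ * h (U ω)) / g p.1 = κ := by
      intro p
      rw [hES κ hκpos p.1 p.2, mul_div_assoc, div_self (hg3 p.1 p.2).ne', mul_one]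
    simp only [this]
    exact ciSup_const
  · intro L hL hLx
    obtain ⟨a1, a2, a3⟩ := hfeas L hL hLx
    have : ∫ t, (∫ ω in {ω | t ≤ U ω}, L ω ∂P) ∂φ0 ≤ ∫ t, kG P g L * ((1 - t) * g t) ∂φ0 := by
      refine integral_mono_ae a2 (hgi.const_mul _) ?_
      filter_upwards [hmem0] with t ht using a1 t ht
    rw [integral_const_mul, ← hIM] at this
    rw [hκ, div_le_iff₀ hIpos]
    linarith
  · intro hcont L hL hLx hkG
    obtain ⟨a1, a2, a3⟩ := hfeas L hL hLx
    obtain ⟨hLm, hL0, C, hLC⟩ := memE_props hL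
    rw [hkG] at a1
    have hLi := bdd_integrable hLm hLC
    -- `φ` charges every interval
    have hpos : ∀ s t : ℝ, 0 ≤ s → s < t → t < 1 → φ0 (Ioc s t) ≠ 0 := by
      intro s t hs hst ht hz
      have hconst : ∀ u ∈ Ioo s t, φ0 (Iic u) = φ0 (Iic s) := by
        intro u hu
        refine le_antisymm ?_ (measure_mono (Iic_subset_Iic.2 hu.1.le))
        rw [← Iic_union_Ioc_eq_Iic hu.1.le]
        refine (measure_union_le _ _).trans ?_
        have : φ0 (Ioc s u) = 0 := measure_mono_null (Ioc_subset_Ioc_right hu.2.le) hz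
        rw [this, add_zero]
      have h1 : P {ω | U ω ∈ Ioo s t} ≤ P {ω | D ω = (φ0 (Iic s)).toReal} := by
        refine measure_mono_ae ?_
        filter_upwards [hDU'] with ω hω (hm : U ω ∈ Ioo s t)
        show D ω = (φ0 (Iic s)).toReal
        rw [← hconst _ hm, hω, ENNReal.toReal_ofReal (hDpos ω)]
      rw [hcont, P_Ioo hUmeas hUdist hs ht.le] at h1
      simp at h1
      linarith
    -- equality almost everywhere
    have hzero : ∀ᵐ t ∂φ0, κ * ((1 - t) * g t) - ∫ ω in {ω | t ≤ U ω}, L ω ∂P = 0 := by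
      have hnn : 0 ≤ᵐ[φ0] fun t => κ * ((1 - t) * g t) - ∫ ω in {ω | t ≤ U ω}, L ω ∂P := by
        filter_upwards [hmem0] with t ht
        exact sub_nonneg.2 (a1 t ht)
      have hi := (hgi.const_mul κ).sub a2
      have hle : ∫ t, (κ * ((1 - t) * g t) - ∫ ω in {ω | t ≤ U ω}, L ω ∂P) ∂φ0 = 0 := by
        refine le_antisymm ?_ (integral_nonneg_of_ae hnn)
        rw [integral_sub (hgi.const_mul κ) a2, integral_const_mul, ← hIM, hκI]
        linarith
      exact (integral_eq_zero_iff_of_nonneg_ae hnn hi).1 hle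
    have heq : ∀ t ∈ Ico (0:ℝ) 1, ∫ ω in {ω | t ≤ U ω}, L ω ∂P = κ * ((1 - t) * g t) := by
      intro t ht
      by_contra hne
      have hlt := lt_of_le_of_ne (a1 t ht) hne
      have hcw : Tendsto (fun s => κ * f s) (nhdsWithin t (Icc 0 1)) (nhds (κ * f t)) :=
        (hfc t ⟨ht.1, ht.2.le⟩).const_mul κ
      have hcw' : Tendsto (fun s => κ * f s) (nhdsWithin t (Ioi t)) (nhds (κ * f t)) := by
        refine hcw.mono_left ?_
        rw [← nhdsWithin_Ioo_eq_nhdsGT ht.2]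
        exact nhdsWithin_mono _ fun x hx => ⟨ht.1.trans hx.1.le, hx.2.le⟩
      have hev := hcw'.eventually (lt_mem_nhds hlt)
      obtain ⟨b, hb, hb'⟩ := (mem_nhdsGT_iff_exists_Ioo_subset' ht.2).1 hev
      have hb0 : t < b := hb
      set b' := (t + min b 1) / 2 with hb'd
      have m1 : t < min b 1 := lt_min hb0 ht.2
      have c1 : t < b' := by rw [hb'd]; linarith
      have c2 : b' < b := by
        have := min_le_left b 1
        rw [hb'd]; linarith
      have c3 : b' < 1 := by
        have := min_le_right b 1
        rw [hb'd]; linarith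
      refine hpos t b' ht.1 c1 c3 ?_
      refine measure_mono_null ?_ (ae_iff.1 hzero)
      intro s hs
      have d1 : (∫ ω in {ω | t ≤ U ω}, L ω ∂P) < κ * f s := hb' ⟨hs.1, hs.2.trans_lt c2⟩
      have d2 : (∫ ω in {ω | s ≤ U ω}, L ω ∂P) ≤ ∫ ω in {ω | t ≤ U ω}, L ω ∂P := by
        refine setIntegral_mono_set hLi.integrableOn (ae_restrict_of_ae hL0) ?_
        exact (Eventually.of_forall fun ω (hω : s ≤ U ω) => hs.1.le.trans hω)
      have d3 : κ * f s = κ * ((1 - s) * g s) := rfl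
      show ¬ (κ * ((1 - s) * g s) - ∫ ω in {ω | s ≤ U ω}, L ω ∂P = 0)
      intro hz
      linarith
    have hkm : AEMeasurable (fun ω => -κ * h (U ω)) P := hhm.const_mul _
    have hkb : ∀ᵐ ω ∂P, |(-κ * h (U ω))| ≤ κ * (-m) := by
      filter_upwards [hhb] with ω hω
      rw [abs_mul, abs_neg, abs_of_pos hκpos]
      exact mul_le_mul_of_nonneg_left hω hκpos.le
    have hES2 : ∀ t ∈ Ico (0:ℝ) 1, ES P t (fun ω => -L ω) = κ * g t := by
      intro t ht
      have e1 := ES_lower hUmeas hUdist hLm hLC ht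
      have e2 := ES_le_kG hLm hLC hg1 hg3 (t := t) ⟨ht.1, ht.2.le⟩
      rw [hkG] at e2
      rw [heq t ht] at e1
      refine le_antisymm e2 ?_
      refine le_of_mul_le_mul_left (a := 1 - t) ?_ (by linarith [ht.2])
      linarith
    have hsq : ∫ ω, (-L ω) ^ 2 ∂P = ∫ ω, (κ * h (U ω)) ^ 2 ∂P := by
      have hkm' : AEMeasurable (fun ω => κ * h (U ω)) P := hhm.const_mul _
      have hkb' : ∀ᵐ ω ∂P, |κ * h (U ω)| ≤ κ * (-m) := by
        filter_upwards [hkb] with ω hω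
        rwa [neg_mul, abs_neg] at hω
      refine qf_ae_eq hLm.neg hkm' (C := C) (by simpa using hLC) hkb' ?_
      intro a ha
      have e1 := hES2 (1 - a) ⟨by linarith [ha.2], by linarith [ha.1]⟩
      have e2 := hES κ hκpos (1 - a) ⟨by linarith [ha.2], by linarith [ha.1]⟩
      rw [← e2] at e1
      unfold ES at e1
      rw [if_pos (by linarith [ha.1]), if_pos (by linarith [ha.1]), sub_sub_cancel] at e1
      have ha0 : a ≠ 0 := ha.1.ne'
      exact mul_left_cancel₀ (by simpa using ha0) e1
    obtain ⟨k, hkk, hke⟩ := aem_anti hanti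
    refine final_eq hUmeas hUdist hLm hkm hLC hkb hL0 ?_ (k := fun u => -κ * k u) (by fun_prop)
      ?_ ?_ ?_
    · filter_upwards [U_mem hUmeas hUdist] with ω hω
      have := (hg6 _ hω).2
      have : h (U ω) ≤ 0 := by linarith
      nlinarith
    · filter_upwards [U_ae hUmeas hUdist hke] with ω hω
      rw [hω]
    · intro t ht
      rw [heq t ht, integral_const_mul, hset t ⟨ht.1, ht.2.le⟩]
      ring
    · have e1 : (fun ω => (-L ω) ^ 2) = fun ω => L ω ^ 2 := by ext ω; ring
      have e2 : (fun ω => (κ * h (U ω)) ^ 2) = fun ω => (-κ * h (U ω)) ^ 2 := by ext ω; ring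
      rw [e1, e2] at hsq
      exact hsq


end Paper
end
end
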